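/- Let (s_{1,1}, …, s_{1,m}) = N(σ_1, …, σ_m) be a Nikishin system with m ≥ 1 and let n = (n_0, …, n_m) ∈ ℤ₊^{m+1} be such that n_j = max{n_0 + 1, n_1, …, n_m} for some j ∈ {1, …, m}. Then there exist measures σ_1*, …, σ_m* with σ_k* ∈ M(Δ_k') for some interval Δ_k' ⊆ Δ_k, forming a Nikishin system (s*_{1,1}, …, s*_{1,m}) = N(σ_1*, …, σ_m*), and a multi-index n* = (n_0*, …, n_m*) which is a permutation of n with n_0* = n_j, such that: for all real polynomials p_0, …, p_m with deg p_k ≤ n_k − 1 there exist real polynomials p_0*, …, p_m* with deg p_k* ≤ n_k* − 1 satisfying, for every z ∈ ℂ ∖ Δ_1, p_0(z) + Σ_{k=1}^m p_k(z)·ŝ_{1,k}(z) = (p_0*(z) + Σ_{k=1}^m p_k*(z)·ŝ*_{1,k}(z)) · ŝ_{1,j}(z). -/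

import Mathlib

open MeasureTheory Set Polynomial Filter

noncomputable section

/-- A signed Borel measure on `ℝ`, represented by a pair of (nonnegative) measures
(a "positive part" and a "negative part"). -/
structure SignedM where
  pos : MeasureTheory.Measure ℝ
  neg : MeasureTheory.Measure ℝ

namespace SignedM

/-- Integral of a complex-valued function against a signed measure. -/
def cintegral (s : SignedM) (f : ℝ → ℂ) : ℂ :=
  (∫ x, f x ∂s.pos) - ∫ x, f x ∂s.neg

/-- Integral of a real-valued function against a signed measure. -/
def rintegral (s : SignedM) (f : ℝ → ℝ) : ℝ :=
  (∫ x, f x ∂s.pos) - ∫ x, f x ∂s.neg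

/-- The Cauchy transform `ŝ(z) = ∫ ds(x)/(z - x)` at a complex point. -/
def cauchy (s : SignedM) (z : ℂ) : ℂ :=
  s.cintegral fun x => (z - (x : ℂ))⁻¹

/-- The Cauchy transform at a real point (real-valued). -/
def cauchyR (s : SignedM) (x : ℝ) : ℝ :=
  s.rintegral fun t => (x - t)⁻¹

/-- The total variation `|s|` (for the constant-sign representation used here). -/
def mass (s : SignedM) : ℝ :=
  (s.pos Set.univ).toReal + (s.neg Set.univ).toReal

/-- The (topological) support of a nonnegative measure. -/
def msupport (μ : MeasureTheory.Measure ℝ) : Set ℝ :=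
  {x | ∀ U : Set ℝ, IsOpen U → x ∈ U → μ U ≠ 0}

/-- The support of a signed measure. -/
def supp (s : SignedM) : Set ℝ := msupport s.pos ∪ msupport s.neg

/-- The signed measure `g·s` with (real, possibly sign-changing) density `g` w.r.t. `s`. -/
def withDensityR (s : SignedM) (g : ℝ → ℝ) : SignedM where
  pos := s.pos.withDensity (fun x => ENNReal.ofReal (g x)) +
    s.neg.withDensity (fun x => ENNReal.ofReal (-g x))
  neg := s.pos.withDensity (fun x => ENNReal.ofReal (-g x)) +
    s.neg.withDensity (fun x => ENNReal.ofReal (g x))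

/-- The product `⟨a, b⟩`: the measure with density `b̂` with respect to `a`. -/
def nik (a b : SignedM) : SignedM := a.withDensityR b.cauchyR

end SignedM

/-- `s ∈ M(Δ)`: a finite Borel measure with constant sign, whose support is compact and
consists of infinitely many points, `Δ` being the smallest closed interval containing it. -/
structure IsM (s : SignedM) (Δ : Set ℝ) : Prop where
  posFinite : MeasureTheory.IsFiniteMeasure s.pos
  negFinite : MeasureTheory.IsFiniteMeasure s.neg
  constSign : s.pos = 0 ∨ s.neg = 0
  compactSupp : IsCompact s.supp
  infiniteSupp : s.supp.Infinite
  hullEq : Δ = Set.Icc (sInf s.supp) (sSup s.supp)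

/-- A set of reals, viewed inside `ℂ`. -/
def cSet (Δ : Set ℝ) : Set ℂ := (fun x : ℝ => (x : ℂ)) '' Δ

/-- `τ` is the inverse measure of `s`: `1/ŝ(z) = z/|s| + b + τ̂(z)` on `ℂ ∖ Δ`. -/
def IsInverse (s τ : SignedM) (Δ : Set ℝ) : Prop :=
  ∃ b : ℝ, ∀ z : ℂ, z ∉ cSet Δ →
    (s.cauchy z)⁻¹ = z / (s.mass : ℂ) + (b : ℂ) + τ.cauchy z

/-- The iterated products `s_{j,k} = ⟨σ_j, σ_{j+1}, …, σ_k⟩` of a Nikishin system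
(`s_{j,k} = σ_j` when `j ≥ k`). -/
def nikSys (σ : ℕ → SignedM) : ℕ → ℕ → SignedM
  | j, k => if h : j < k then (σ j).nik (nikSys σ (j + 1) k) else σ j
  termination_by j k => k - j
  decreasing_by omega

theorem integrable_of_continuousOn_of_null {X E : Type*} [TopologicalSpace X] [T2Space X]
    [MeasurableSpace X] [OpensMeasurableSpace X] [NormedAddCommGroup E]
    {μ : Measure X} [IsFiniteMeasure μ] {K : Set X} (hK : IsCompact K) (h : μ Kᶜ = 0) {f : X → E}
    (hf : ContinuousOn f K) : Integrable f μ := by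
  have h1 := hf.integrableOn_compact (μ := μ) hK
  rwa [IntegrableOn, Measure.restrict_eq_self_of_ae_mem (mem_ae_iff.2 h)] at h1

theorem SignedM.msupport_eq_support (μ : Measure ℝ) : SignedM.msupport μ = μ.support := by
  rw [Measure.support_eq_forall_isOpen]
  ext x
  simp only [SignedM.msupport, Set.mem_ofPred_eq, pos_iff_ne_zero]
  exact ⟨fun h U hx hU => h U hU hx, fun h U hU hx => h U hx hU⟩

theorem isClosed_cSet {K : Set ℝ} (hK : IsCompact K) : IsClosed (cSet K) :=
  (hK.image Complex.continuous_ofReal).isClosed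

theorem ofReal_mem_cSet {K : Set ℝ} {x : ℝ} : (x : ℂ) ∈ cSet K ↔ x ∈ K := by
  simp [cSet]

theorem sub_ofReal_ne_zero {K : Set ℝ} {z : ℂ} (hz : z ∉ cSet K) {x : ℝ} (hx : x ∈ K) :
    z - (x : ℂ) ≠ 0 := fun h => hz ⟨x, hx, (sub_eq_zero.1 h).symm⟩

theorem continuousOn_resolvent {K : Set ℝ} {z : ℂ} (hz : z ∉ cSet K) :
    ContinuousOn (fun x : ℝ => (z - (x : ℂ))⁻¹) K :=
  ContinuousOn.inv₀ (by fun_prop) fun _ hx => sub_ofReal_ne_zero hz hx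

namespace SignedM

/-- The measure `s` is finite and lives on the compact set `K`. -/
structure Carried (s : SignedM) (K : Set ℝ) : Prop where
  posFinite : IsFiniteMeasure s.pos
  negFinite : IsFiniteMeasure s.neg
  posNull : s.pos Kᶜ = 0
  negNull : s.neg Kᶜ = 0
  compact : IsCompact K

/-- The signed total mass of `s`. -/
def total (s : SignedM) : ℝ := s.rintegral fun _ => 1

theorem cintegral_ofReal (s : SignedM) (f : ℝ → ℝ) :
    s.cintegral (fun x => (f x : ℂ)) = (s.rintegral f : ℂ) := by
  simp only [cintegral, rintegral, Complex.ofReal_sub, integral_complex_ofReal]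

theorem cauchy_ofReal (s : SignedM) (x : ℝ) : s.cauchy (x : ℂ) = (s.cauchyR x : ℂ) := by
  unfold cauchy cauchyR
  rw [← cintegral_ofReal]
  push_cast
  rfl

theorem cintegral_one (s : SignedM) : s.cintegral (fun _ => 1) = (s.total : ℂ) := by
  rw [total, ← cintegral_ofReal]
  simp

theorem cintegral_const_mul (s : SignedM) (c : ℂ) (f : ℝ → ℂ) :
    s.cintegral (fun x => c * f x) = c * s.cintegral f := by
  simp only [cintegral, integral_const_mul, mul_sub]

namespace Carried

variable {s a b : SignedM} {K K' : Set ℝ} {f g : ℝ → ℂ}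

theorem integrable_pos {E : Type*} [NormedAddCommGroup E] {f : ℝ → E} (h : s.Carried K)
    (hf : ContinuousOn f K) : Integrable f s.pos :=
  have := h.posFinite
  integrable_of_continuousOn_of_null h.compact h.posNull hf

theorem integrable_neg {E : Type*} [NormedAddCommGroup E] {f : ℝ → E} (h : s.Carried K)
    (hf : ContinuousOn f K) : Integrable f s.neg :=
  have := h.negFinite
  integrable_of_continuousOn_of_null h.compact h.negNull hf

theorem cintegral_congr (h : s.Carried K) (hfg : ∀ x ∈ K, f x = g x) :
    s.cintegral f = s.cintegral g := by
  have h1 : f =ᵐ[s.pos] g := by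
    filter_upwards [mem_ae_iff.2 h.posNull] with x hx using hfg x hx
  have h2 : f =ᵐ[s.neg] g := by
    filter_upwards [mem_ae_iff.2 h.negNull] with x hx using hfg x hx
  rw [cintegral, cintegral, integral_congr_ae h1, integral_congr_ae h2]

theorem cintegral_add (h : s.Carried K) (hf : ContinuousOn f K) (hg : ContinuousOn g K) :
    s.cintegral (fun x => f x + g x) = s.cintegral f + s.cintegral g := by
  rw [cintegral, integral_add (h.integrable_pos hf) (h.integrable_pos hg),
    integral_add (h.integrable_neg hf) (h.integrable_neg hg), cintegral, cintegral]
  ring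

theorem cintegral_sub (h : s.Carried K) (hf : ContinuousOn f K) (hg : ContinuousOn g K) :
    s.cintegral (fun x => f x - g x) = s.cintegral f - s.cintegral g := by
  rw [cintegral, integral_sub (h.integrable_pos hf) (h.integrable_pos hg),
    integral_sub (h.integrable_neg hf) (h.integrable_neg hg), cintegral, cintegral]
  ring

theorem cintegral_finset_sum {ι : Type*} (h : s.Carried K) (t : Finset ι) (F : ι → ℝ → ℂ)
    (hF : ∀ i ∈ t, ContinuousOn (F i) K) :
    s.cintegral (fun x => ∑ i ∈ t, F i x) = ∑ i ∈ t, s.cintegral (F i) := by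
  simp only [cintegral, Finset.sum_sub_distrib]
  rw [integral_finsetSum _ fun i hi => h.integrable_pos (hF i hi),
    integral_finsetSum _ fun i hi => h.integrable_neg (hF i hi)]

theorem withDensityR {g : ℝ → ℝ} (h : s.Carried K) (hg : ContinuousOn g K) :
    (s.withDensityR g).Carried K := by
  have h1 := (h.integrable_pos hg).hasFiniteIntegral
  have h2 := (h.integrable_neg hg).hasFiniteIntegral
  have h3 := (h.integrable_pos hg.neg).hasFiniteIntegral
  have h4 := (h.integrable_neg hg.neg).hasFiniteIntegral
  have := isFiniteMeasure_withDensity_ofReal h1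
  have := isFiniteMeasure_withDensity_ofReal h2
  have := isFiniteMeasure_withDensity_ofReal h3
  have := isFiniteMeasure_withDensity_ofReal h4
  have e1 (f : ℝ → ENNReal) : s.pos.withDensity f Kᶜ = 0 :=
    withDensity_absolutelyContinuous _ _ h.posNull
  have e2 (f : ℝ → ENNReal) : s.neg.withDensity f Kᶜ = 0 :=
    withDensity_absolutelyContinuous _ _ h.negNull
  refine ⟨?_, ?_, ?_, ?_, h.compact⟩
  · simp only [SignedM.withDensityR]
    exact inferInstanceAs (IsFiniteMeasure (_ + s.neg.withDensity fun x => ENNReal.ofReal ((-g) x)))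
  · simp only [SignedM.withDensityR]
    exact inferInstanceAs (IsFiniteMeasure ((s.pos.withDensity fun x => ENNReal.ofReal ((-g) x)) + _))
  · simp [SignedM.withDensityR, e1, e2]
  · simp [SignedM.withDensityR, e1, e2]

theorem cintegral_withDensityR {g : ℝ → ℝ} (h : s.Carried K) (hg : ContinuousOn g K)
    (hf : ContinuousOn f K) :
    (s.withDensityR g).cintegral f = s.cintegral (fun x => (g x : ℂ) * f x) := by
  have h' := h.withDensityR hg
  have i1 := h'.integrable_pos hf
  have i2 := h'.integrable_neg hf
  have m1 : AEMeasurable g s.pos := (h.integrable_pos hg).aestronglyMeasurable.aemeasurable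
  have m2 : AEMeasurable g s.neg := (h.integrable_neg hg).aestronglyMeasurable.aemeasurable
  have m1' : AEMeasurable (fun x => -g x) s.pos := m1.neg
  have m2' : AEMeasurable (fun x => -g x) s.neg := m2.neg
  have c1 : ContinuousOn (fun x => (max (g x) 0 : ℝ) • f x) K := by fun_prop
  have c2 : ContinuousOn (fun x => (max (-g x) 0 : ℝ) • f x) K := by fun_prop
  simp only [SignedM.withDensityR] at i1 i2
  rw [integrable_add_measure] at i1 i2
  simp only [cintegral, SignedM.withDensityR]
  rw [integral_add_measure i1.1 i1.2, integral_add_measure i2.1 i2.2,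
    integral_withDensity_eq_integral_toReal_smul₀ m1.ennreal_ofReal (by simp),
    integral_withDensity_eq_integral_toReal_smul₀ m2'.ennreal_ofReal (by simp),
    integral_withDensity_eq_integral_toReal_smul₀ m1'.ennreal_ofReal (by simp),
    integral_withDensity_eq_integral_toReal_smul₀ m2.ennreal_ofReal (by simp)]
  simp only [ENNReal.toReal_ofReal']
  have e (x : ℝ) : (g x : ℂ) * f x = (max (g x) 0 : ℝ) • f x - (max (-g x) 0 : ℝ) • f x := by
    rw [← sub_smul, Complex.real_smul, max_zero_sub_eq_self]
  simp only [e]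
  rw [integral_sub (h.integrable_pos c1) (h.integrable_pos c2),
    integral_sub (h.integrable_neg c1) (h.integrable_neg c2)]
  ring

theorem integrable_prod {μ ν : Measure ℝ} [IsFiniteMeasure μ] [IsFiniteMeasure ν]
    (hK : IsCompact K) (hK' : IsCompact K') (hμ : μ Kᶜ = 0) (hν : ν K'ᶜ = 0) {F : ℝ → ℝ → ℂ}
    (hF : ContinuousOn (Function.uncurry F) (K ×ˢ K')) :
    Integrable (Function.uncurry F) (μ.prod ν) := by
  refine integrable_of_continuousOn_of_null (hK.prod hK') ?_ hF
  rw [Set.compl_prod_eq_union]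
  refine measure_union_null ?_ ?_ <;> rw [Measure.prod_prod] <;> simp [hμ, hν]

theorem cintegral_comm (ha : a.Carried K) (hb : b.Carried K') {F : ℝ → ℝ → ℂ}
    (hF : ContinuousOn (Function.uncurry F) (K ×ˢ K')) :
    a.cintegral (fun x => b.cintegral (F x)) =
      b.cintegral (fun t => a.cintegral fun x => F x t) := by
  have := ha.posFinite
  have := ha.negFinite
  have := hb.posFinite
  have := hb.negFinite
  have i1 := integrable_prod ha.compact hb.compact ha.posNull hb.posNull hF
  have i2 := integrable_prod ha.compact hb.compact ha.posNull hb.negNull hF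
  have i3 := integrable_prod ha.compact hb.compact ha.negNull hb.posNull hF
  have i4 := integrable_prod ha.compact hb.compact ha.negNull hb.negNull hF
  simp only [cintegral]
  have j1 := i1.integral_prod_left
  have j2 := i2.integral_prod_left
  have j3 := i3.integral_prod_left
  have j4 := i4.integral_prod_left
  have k1 := i1.integral_prod_right
  have k2 := i2.integral_prod_right
  have k3 := i3.integral_prod_right
  have k4 := i4.integral_prod_right
  simp only [Function.uncurry] at j1 j2 j3 j4 k1 k2 k3 k4
  rw [integral_sub j1 j2, integral_sub j3 j4, integral_sub k1 k3, integral_sub k2 k4,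
    integral_integral_swap i1, integral_integral_swap i2, integral_integral_swap i3,
    integral_integral_swap i4]
  ring

theorem continuousOn_cauchy (h : s.Carried K) : ContinuousOn s.cauchy (cSet K)ᶜ := by
  intro z hz
  obtain ⟨δ, hδ, hball⟩ := Metric.isOpen_iff.1 (isClosed_cSet h.compact).isOpen_compl z hz
  have key : ∀ᶠ w in nhds z, ∀ x ∈ K, ‖(w - (x : ℂ))⁻¹‖ ≤ 2 / δ := by
    filter_upwards [Metric.ball_mem_nhds z (half_pos hδ)] with w hw x hx
    have h1 : δ ≤ dist (x : ℂ) z := by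
      by_contra hlt
      exact hball (not_le.1 hlt) ⟨x, hx, rfl⟩
    have h2 : dist w z < δ / 2 := hw
    have h3 : dist (x : ℂ) z ≤ dist w x + dist w z := by
      rw [dist_comm w x]; exact dist_triangle _ _ _
    rw [norm_inv, ← dist_eq_norm, ← one_div_div]
    rw [one_div]
    exact inv_anti₀ (half_pos hδ) (by linarith)
  have hopen : ∀ᶠ w in nhds z, w ∉ cSet K := (isClosed_cSet h.compact).isOpen_compl.mem_nhds hz
  have hcont : ∀ x ∈ K, ContinuousAt (fun w : ℂ => (w - (x : ℂ))⁻¹) z := fun x hx =>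
    ContinuousAt.inv₀ (by fun_prop) (sub_ofReal_ne_zero hz hx)
  have := h.posFinite
  have := h.negFinite
  refine ContinuousAt.continuousWithinAt (ContinuousAt.sub ?_ ?_)
  · refine continuousAt_of_dominated (bound := fun _ => 2 / δ) ?_ ?_ (integrable_const _) ?_
    · filter_upwards [hopen] with w hw
      exact (h.integrable_pos (continuousOn_resolvent hw)).aestronglyMeasurable
    · filter_upwards [key] with w hw
      filter_upwards [mem_ae_iff.2 h.posNull] with x hx using hw x hx
    · filter_upwards [mem_ae_iff.2 h.posNull] with x hx using hcont x hx
  · refine continuousAt_of_dominated (bound := fun _ => 2 / δ) ?_ ?_ (integrable_const _) ?_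
    · filter_upwards [hopen] with w hw
      exact (h.integrable_neg (continuousOn_resolvent hw)).aestronglyMeasurable
    · filter_upwards [key] with w hw
      filter_upwards [mem_ae_iff.2 h.negNull] with x hx using hw x hx
    · filter_upwards [mem_ae_iff.2 h.negNull] with x hx using hcont x hx

theorem continuousOn_cauchyR (h : s.Carried K) : ContinuousOn s.cauchyR Kᶜ := by
  have h1 : ContinuousOn (fun x : ℝ => (s.cauchy (x : ℂ)).re) Kᶜ :=
    Complex.continuous_re.comp_continuousOn
      (h.continuousOn_cauchy.comp Complex.continuous_ofReal.continuousOn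
        fun x hx hx' => hx (ofReal_mem_cSet.1 hx'))
  refine h1.congr fun x _ => ?_
  simp only [cauchy_ofReal, Complex.ofReal_re]

theorem tendsto_cauchy (h : s.Carried K) :
    Tendsto (fun r : ℝ => s.cauchy (r : ℂ)) atTop (nhds 0) := by
  obtain ⟨M, hM⟩ := h.compact.isBounded.subset_closedBall 0
  have hx (x : ℝ) (hx : x ∈ K) : |x| ≤ M := by simpa using hM hx
  have := h.posFinite
  have := h.negFinite
  have hmem : ∀ᶠ r : ℝ in atTop, ((r : ℂ)) ∉ cSet K := by
    filter_upwards [eventually_gt_atTop M] with r hr hr'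
    exact absurd ((le_abs_self r).trans (hx r (ofReal_mem_cSet.1 hr'))) (not_le.2 hr)
  have hbd : ∀ᶠ r : ℝ in atTop, ∀ x ∈ K, ‖((r : ℂ) - (x : ℂ))⁻¹‖ ≤ 1 := by
    filter_upwards [eventually_ge_atTop (M + 1)] with r hr x hxK
    rw [norm_inv, ← Complex.ofReal_sub, Complex.norm_real]
    refine inv_le_one_of_one_le₀ ?_
    have := (le_abs_self x).trans (hx x hxK)
    exact le_trans (by linarith) (le_abs_self (r - x))
  have hlim (x : ℝ) : Tendsto (fun r : ℝ => ((r : ℂ) - (x : ℂ))⁻¹) atTop (nhds 0) := by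
    have : Tendsto (fun r : ℝ => (((r - x)⁻¹ : ℝ) : ℂ)) atTop (nhds ((0 : ℝ) : ℂ)) :=
      (Complex.continuous_ofReal.tendsto _).comp
        (tendsto_inv_atTop_zero.comp (tendsto_atTop_add_const_right _ (-x) tendsto_id))
    simpa using this
  have e : (0 : ℂ) = (∫ _, (0 : ℂ) ∂s.pos) - ∫ _, (0 : ℂ) ∂s.neg := by simp
  rw [e]
  refine Tendsto.sub ?_ ?_
  · refine tendsto_integral_filter_of_dominated_convergence (fun _ => 1) ?_ ?_
      (integrable_const _) (Eventually.of_forall hlim)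
    · filter_upwards [hmem] with w hw
      exact (h.integrable_pos (continuousOn_resolvent hw)).aestronglyMeasurable
    · filter_upwards [hbd] with w hw
      filter_upwards [mem_ae_iff.2 h.posNull] with x hx using hw x hx
  · refine tendsto_integral_filter_of_dominated_convergence (fun _ => 1) ?_ ?_
      (integrable_const _) (Eventually.of_forall hlim)
    · filter_upwards [hmem] with w hw
      exact (h.integrable_neg (continuousOn_resolvent hw)).aestronglyMeasurable
    · filter_upwards [hbd] with w hw
      filter_upwards [mem_ae_iff.2 h.negNull] with x hx using hw x hx

theorem eventually_notMem (h : s.Carried K) : ∀ᶠ r : ℝ in atTop, (r : ℂ) ∉ cSet K := by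
  obtain ⟨M, hM⟩ := h.compact.isBounded.subset_closedBall 0
  filter_upwards [eventually_gt_atTop M] with r hr hr'
  have : |r| ≤ M := by simpa using hM (ofReal_mem_cSet.1 hr')
  exact absurd ((le_abs_self r).trans this) (not_le.2 hr)

theorem cintegral_mul_resolvent (h : s.Carried K) (hf : ContinuousOn f K) {z : ℂ}
    (hz : z ∉ cSet K) :
    s.cintegral (fun x => (x : ℂ) * f x * (z - x)⁻¹) =
      z * s.cintegral (fun x => f x * (z - x)⁻¹) - s.cintegral f := by
  have hr := continuousOn_resolvent hz
  rw [← cintegral_const_mul, ← h.cintegral_sub (by fun_prop) hf]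
  refine h.cintegral_congr fun x hx => ?_
  have := sub_ofReal_ne_zero hz hx
  field_simp
  ring

theorem tendsto_mul_cauchy (h : s.Carried K) :
    Tendsto (fun r : ℝ => (r : ℂ) * s.cauchy (r : ℂ)) atTop (nhds (s.total : ℂ)) := by
  have h1 := (h.withDensityR (g := fun x => x) continuousOn_id).tendsto_cauchy.add_const
    (s.total : ℂ)
  rw [zero_add] at h1
  refine h1.congr' ?_
  filter_upwards [h.eventually_notMem] with r hr
  have h2 := h.cintegral_mul_resolvent (f := fun _ => 1) continuousOn_const hr
  rw [cauchy, h.cintegral_withDensityR (g := fun x => x) continuousOn_id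
    (continuousOn_resolvent hr)]
  simp only [mul_one, one_mul] at h2
  rw [h2, cintegral_one, cauchy]
  ring

end Carried

end SignedM

/-- A selfadjoint operator with spectrum in `[p, q]` has a finite spectral measure on `[p, q]`
attached to each vector `u`, expressing the resolvent quadratic form. -/
theorem exists_spectral_measure {H : Type*} [NormedAddCommGroup H] [InnerProductSpace ℂ H]
    [CompleteSpace H] (T : H →L[ℂ] H) (hT : IsSelfAdjoint T) {p q : ℝ}
    (hspec : spectrum ℝ T ⊆ Icc p q) (u : H) :
    ∃ τ : Measure ℝ, IsFiniteMeasure τ ∧ τ (Icc p q)ᶜ = 0 ∧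
      ∀ z ∉ cSet (Icc p q), ∀ (c : ℂ) (w : H), z • w - T w = c • u →
        inner ℂ u w = c * ∫ x : ℝ, (z - (x : ℂ))⁻¹ ∂τ := by
  have : CompactSpace (spectrum ℝ T) := ContinuousFunctionalCalculus.compactSpace_spectrum T
  let φ := cfcHom (R := ℝ) hT
  have hsa (g : C(spectrum ℝ T, ℝ)) : IsSelfAdjoint (φ g) := by
    have : star g = g := by ext x; simp
    rw [IsSelfAdjoint, ← map_star, this]
  have hreal (g : C(spectrum ℝ T, ℝ)) : ((inner ℂ u (φ g u)).re : ℂ) = inner ℂ u (φ g u) := by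
    rw [← Complex.conj_eq_iff_re, inner_conj_symm]
    exact (ContinuousLinearMap.isSelfAdjoint_iff_isSymmetric.1 (hsa g)) u u
  let Λ₀ : CompactlySupportedContinuousMap (spectrum ℝ T) ℝ →ₗ[ℝ] ℝ :=
    { toFun f := (inner ℂ u (φ f.toContinuousMap u)).re
      map_add' f g := by
        have : (f + g).toContinuousMap = f.toContinuousMap + g.toContinuousMap := rfl
        rw [this, map_add, add_apply, inner_add_right, Complex.add_re]
      map_smul' c f := by
        have : (c • f).toContinuousMap = c • f.toContinuousMap := rfl
        rw [this, map_smul, smul_apply, ← Complex.coe_smul, inner_smul_right,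
          Complex.re_ofReal_mul]
        rfl }
  let Λ := PositiveLinearMap.mk₀ Λ₀ fun f hf => by
    have h1 : 0 ≤ φ f.toContinuousMap := cfcHom_nonneg_iff hT |>.2 hf
    have h2 := (ContinuousLinearMap.nonneg_iff_isPositive _).1 h1
    exact h2.re_inner_nonneg_right u
  let ν := RealRMK.rieszMeasure Λ
  have hν : IsFiniteMeasure ν := inferInstance
  have key (g : C(spectrum ℝ T, ℝ)) : ∫ x, ((g x : ℝ) : ℂ) ∂ν = inner ℂ u (φ g u) := by
    rw [integral_complex_ofReal, ← hreal]
    congr 1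
    exact RealRMK.integral_rieszMeasure Λ (CompactlySupportedContinuousMap.continuousMapEquiv g)
  refine ⟨ν.map Subtype.val, inferInstance, ?_, fun z hz c w hw => ?_⟩
  · rw [Measure.map_apply measurable_subtype_coe measurableSet_Icc.compl]
    convert measure_empty (μ := ν)
    ext x
    simpa using hspec x.2
  rw [integral_map measurable_subtype_coe.aemeasurable (by fun_prop)]
  have hz' (x : spectrum ℝ T) : z - ((x : ℝ) : ℂ) ≠ 0 := sub_ofReal_ne_zero hz (hspec x.2)
  let G : C(spectrum ℝ T, ℂ) := ⟨fun x => (z - ((x : ℝ) : ℂ))⁻¹, by fun_prop (disch := exact hz' _)⟩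
  let g₁ : C(spectrum ℝ T, ℝ) := ⟨fun x => (G x).re, by fun_prop⟩
  let g₂ : C(spectrum ℝ T, ℝ) := ⟨fun x => (G x).im, by fun_prop⟩
  let X : C(spectrum ℝ T, ℝ) := (ContinuousMap.id ℝ).restrict (spectrum ℝ T)
  have hX : φ X = T := cfcHom_id hT
  have e1 : g₁ * (algebraMap ℝ _ z.re - X) - algebraMap ℝ _ z.im * g₂ = 1 := by
    ext x
    have := congrArg Complex.re (inv_mul_cancel₀ (hz' x))
    rw [Complex.mul_re, Complex.sub_re, Complex.sub_im, Complex.ofReal_re, Complex.ofReal_im,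
      sub_zero, Complex.one_re, mul_comm _ z.im] at this
    exact this
  have e2 : g₁ * algebraMap ℝ _ z.im + g₂ * (algebraMap ℝ _ z.re - X) = 0 := by
    ext x
    have := congrArg Complex.im (inv_mul_cancel₀ (hz' x))
    rw [Complex.mul_im, Complex.sub_re, Complex.sub_im, Complex.ofReal_re, Complex.ofReal_im,
      sub_zero, Complex.one_im] at this
    exact this
  have e1' := congrArg φ e1
  have e2' := congrArg φ e2
  simp only [map_sub, map_add, map_mul, AlgHomClass.commutes, hX, map_one, map_zero] at e1' e2'
  have f1 := congrArg (fun A => A w) e1'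
  have f2 := congrArg (fun A => A w) e2'
  simp only [sub_apply, add_apply,
    mul_apply_eq_comp, Algebra.algebraMap_eq_smul_one, smul_apply,
    one_apply_eq_self, zero_apply] at f1 f2
  have hw' : w = c • (φ g₁ u + Complex.I • φ g₂ u) := by
    have hu : c • u = (z.re • w - T w) + Complex.I • (z.im • w) := by
      rw [← hw]
      nth_rewrite 1 [← Complex.re_add_im z]
      simp only [← Complex.coe_smul, smul_smul, add_smul, mul_comm Complex.I]
      abel
    have hI : Complex.I • Complex.I • φ g₂ (z.im • w) = -(z.im • φ g₂ w) := by
      rw [smul_smul, Complex.I_mul_I, ← Complex.coe_smul, map_smul, Complex.coe_smul, neg_one_smul]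
    rw [smul_add, smul_comm c, ← map_smul (φ g₁) c, ← map_smul (φ g₂) c, hu]
    generalize z.re • w - T w = A at f1 f2
    rw [map_add, map_add, (φ g₁).map_smul Complex.I, (φ g₂).map_smul Complex.I, smul_add, hI,
      eq_add_of_sub_eq f1, eq_neg_of_add_eq_zero_right f2, smul_neg]
    abel
  have hsum : inner ℂ u w =
      c * (inner ℂ u (φ g₁ u) + Complex.I * inner ℂ u (φ g₂ u)) := by
    conv_lhs => rw [hw']
    rw [inner_smul_right, inner_add_right, inner_smul_right]
  rw [hsum, ← key, ← key, ← integral_const_mul, ← integral_add]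
  · congr 1
    refine integral_congr_ae (Eventually.of_forall fun x => ?_)
    simp only [g₁, g₂, ContinuousMap.coe_mk]
    rw [mul_comm, Complex.re_add_im]
    rfl
  · exact integrable_of_continuousOn_of_null isCompact_univ (by simp) (by fun_prop)
  · exact integrable_of_continuousOn_of_null isCompact_univ (by simp) (by fun_prop)

/-- Schur complement: compressing a selfadjoint operator `M` to the orthogonal complement of a
unit vector `e` inverts the resolvent function `⟨e, (z - M)⁻¹ e⟩`. -/
theorem exists_schur_measure {H : Type*} [NormedAddCommGroup H] [InnerProductSpace ℂ H]
    [CompleteSpace H] (M : H →L[ℂ] H) (hM : IsSelfAdjoint M) {p q : ℝ} (hpq : p ≤ q)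
    (hp : ∀ f, 0 ≤ (inner ℂ f (M f - (p : ℂ) • f)).re)
    (hq : ∀ f, 0 ≤ (inner ℂ f ((q : ℂ) • f - M f)).re) (e : H) (he : ‖e‖ = 1) :
    ∃ (τ : Measure ℝ) (a : ℝ), IsFiniteMeasure τ ∧ τ (Icc p q)ᶜ = 0 ∧
      ∀ z ∉ cSet (Icc p q), ∀ v : H, z • v - M v = e →
        inner ℂ e v * (z - a - ∫ x : ℝ, (z - (x : ℂ))⁻¹ ∂τ) = 1 := by
  let Q : H →L[ℂ] H := (Submodule.span ℂ {e}).starProjection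
  have hQ (f : H) : Q f = inner ℂ e f • e := Submodule.starProjection_unit_singleton ℂ he f
  have hQs : IsSelfAdjoint Q := isSelfAdjoint_starProjection _
  let P : H →L[ℂ] H := 1 - Q
  have hP (f : H) : P f = f - inner ℂ e f • e := by rw [← hQ]; rfl
  have hee : inner ℂ e e = 1 := by rw [inner_self_eq_norm_sq_to_K, he]; simp
  have hPs : IsSelfAdjoint P := (IsSelfAdjoint.one _).sub hQs
  have hPsym (f g : H) : inner ℂ (P f) g = inner ℂ f (P g) :=
    (ContinuousLinearMap.isSelfAdjoint_iff_isSymmetric.1 hPs) f g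
  have hMsym (f g : H) : inner ℂ (M f) g = inner ℂ f (M g) :=
    (ContinuousLinearMap.isSelfAdjoint_iff_isSymmetric.1 hM) f g
  have hQsym (f g : H) : inner ℂ (Q f) g = inner ℂ f (Q g) :=
    (ContinuousLinearMap.isSelfAdjoint_iff_isSymmetric.1 hQs) f g
  have hPP (f : H) : P (P f) = P f := by
    simp only [hP, inner_sub_right, inner_smul_right, hee]
    simp
  have hQQ (f : H) : Q (Q f) = Q f := by
    simp only [hQ, inner_smul_right, hee, mul_one]
  have hPQ (f : H) : f = P f + Q f := by rw [hP, hQ]; abel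
  let T : H →L[ℂ] H := P * M * P + (p : ℂ) • Q
  have hT (f : H) : T f = P (M (P f)) + (p : ℂ) • Q f := rfl
  have hTs : IsSelfAdjoint T := by
    rw [ContinuousLinearMap.isSelfAdjoint_iff_isSymmetric]
    intro f g
    change inner ℂ (T f) g = inner ℂ f (T g)
    rw [hT, hT, inner_add_left, inner_add_right, hPsym, hMsym, hPsym, inner_smul_left,
      inner_smul_right, hQsym, Complex.conj_ofReal]
  have hdec (c : ℝ) (f : H) : inner ℂ f (T f - (c : ℂ) • f) =
      inner ℂ (P f) (M (P f) - (c : ℂ) • P f) + ((p - c : ℝ) : ℂ) * inner ℂ (Q f) (Q f) := by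
    have h1 : inner ℂ f f = inner ℂ (P f) (P f) + inner ℂ (Q f) (Q f) := by
      rw [hPsym, hPP, hQsym, hQQ, ← inner_add_right, ← hPQ]
    rw [inner_sub_right, hT, inner_add_right, ← hPsym, inner_smul_right, inner_smul_right, h1,
      inner_sub_right, inner_smul_right, hQsym f, hQQ]
    push_cast
    ring
  have hlow : algebraMap ℝ (H →L[ℂ] H) p ≤ T := by
    rw [ContinuousLinearMap.le_def, ContinuousLinearMap.isPositive_def']
    refine ⟨hTs.sub (IsSelfAdjoint.algebraMap _ (.all p)), fun f => ?_⟩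
    rw [ContinuousLinearMap.reApplyInnerSelf_apply, ← inner_re_symm]
    have h1 := congrArg Complex.re (hdec p f)
    rw [sub_self, Complex.ofReal_zero, zero_mul, add_zero] at h1
    exact (hp (P f)).trans_eq h1.symm
  have hupp : T ≤ algebraMap ℝ (H →L[ℂ] H) q := by
    rw [ContinuousLinearMap.le_def, ContinuousLinearMap.isPositive_def']
    refine ⟨(IsSelfAdjoint.algebraMap _ (.all q)).sub hTs, fun f => ?_⟩
    rw [ContinuousLinearMap.reApplyInnerSelf_apply, ← inner_re_symm]
    have h1 := congrArg (fun c => (-c).re) (hdec q f)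
    simp only [neg_add, ← inner_neg_right, neg_sub] at h1
    rw [Complex.add_re, ← neg_mul, ← Complex.ofReal_neg, Complex.re_ofReal_mul, neg_sub] at h1
    exact (add_nonneg (hq (P f)) (mul_nonneg (sub_nonneg.2 hpq)
      (inner_self_nonneg (𝕜 := ℂ) (x := Q f)))).trans_eq h1.symm
  have hspec : spectrum ℝ T ⊆ Icc p q := fun x hx =>
    ⟨(algebraMap_le_iff_le_spectrum (a := T) hTs).1 hlow x hx,
      (le_algebraMap_iff_spectrum_le (a := T) hTs).1 hupp x hx⟩
  obtain ⟨τ, hτ, hτ0, hres⟩ := exists_spectral_measure T hTs hspec (P (M e))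
  refine ⟨τ, (inner ℂ e (M e)).re, hτ, hτ0, fun z hz v hv => ?_⟩
  have ha : (((inner ℂ e (M e)).re : ℝ) : ℂ) = inner ℂ e (M e) := by
    rw [← Complex.conj_eq_iff_re, inner_conj_symm, hMsym]
  have h1 : z • P v - T (P v) = inner ℂ e v • P (M e) := by
    have h2 : Q (P v) = 0 := by rw [hQ, hP, inner_sub_right, inner_smul_right, hee]; simp
    have h3 : M v = z • v - e := by rw [← hv]; abel
    have h4 : P e = 0 := by rw [hP, hee]; simp
    rw [hT, hPP, h2, smul_zero, add_zero, hP v, map_sub, map_sub, map_smul, map_smul, h3, map_sub,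
      map_smul, h4, ← hP]
    abel
  have h5 := hres z hz _ _ h1
  rw [hPsym, hPP, hMsym, hP v, map_sub, inner_sub_right, map_smul, inner_smul_right] at h5
  have h6 : M v = z • v - e := by rw [← hv]; abel
  rw [h6, inner_sub_right, inner_smul_right, hee] at h5
  rw [ha]
  linear_combination h5

/-- The Cauchy transform `S` of a nonzero finite measure on `[p, q]` satisfies
`S(z) (z - a - ν̂(z)) = ‖μ‖` for a finite measure `ν` on `[p, q]`. -/
theorem exists_inverse_measure (μ : Measure ℝ) [IsFiniteMeasure μ] {p q : ℝ} (hpq : p ≤ q)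
    (hμ : μ (Icc p q)ᶜ = 0) (hμ0 : μ ≠ 0) :
    ∃ (τ : Measure ℝ) (a : ℝ), IsFiniteMeasure τ ∧ τ (Icc p q)ᶜ = 0 ∧
      ∀ z ∉ cSet (Icc p q), (∫ x : ℝ, (z - (x : ℂ))⁻¹ ∂μ) *
        (z - a - ∫ x : ℝ, (z - (x : ℂ))⁻¹ ∂τ) = (μ.real univ : ℂ) := by
  have hae : ∀ᵐ x ∂μ, x ∈ Icc p q := mem_ae_iff.2 hμ
  have hmem {f : ℝ → ℂ} (hf : ContinuousOn f (Icc p q)) (r : ENNReal) : MemLp f r μ := by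
    obtain ⟨C, hC⟩ := isCompact_Icc.exists_bound_of_continuousOn hf
    refine MemLp.of_bound
      (integrable_of_continuousOn_of_null isCompact_Icc hμ hf).aestronglyMeasurable C ?_
    filter_upwards [hae] with x hx using hC x hx
  let g : Lp ℂ ⊤ μ := (hmem (f := fun x => (x : ℂ)) (by fun_prop) ⊤).toLp
  have hg : g =ᵐ[μ] fun x => (x : ℂ) := MemLp.coeFn_toLp _
  let M : Lp ℂ 2 μ →L[ℂ] Lp ℂ 2 μ := (ContinuousLinearMap.mul ℂ ℂ).holderL μ ⊤ 2 2 g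
  have hM (f : Lp ℂ 2 μ) : M f =ᵐ[μ] fun x => (x : ℂ) * f x := by
    have h1 : M f =ᵐ[μ] fun x => g x * f x := (ContinuousLinearMap.mul ℂ ℂ).coeFn_holder g f
    filter_upwards [h1, hg] with x h1 h2
    rw [h1, h2]
  have hMs : IsSelfAdjoint M := by
    rw [ContinuousLinearMap.isSelfAdjoint_iff_isSymmetric]
    intro f k
    change inner ℂ (M f) k = inner ℂ f (M k)
    rw [L2.inner_def, L2.inner_def]
    refine integral_congr_ae ?_
    filter_upwards [hM f, hM k] with x h1 h2
    rw [h1, h2]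
    simp only [RCLike.inner_apply, map_mul, Complex.conj_ofReal]
    ring
  have hre (f k : Lp ℂ 2 μ) (w : ℝ → ℝ) (hw : ∀ x ∈ Icc p q, 0 ≤ w x)
      (hk : k =ᵐ[μ] fun x => (w x : ℂ) * f x) : 0 ≤ (inner ℂ f k).re := by
    have h1 : inner ℂ f k = ((∫ x, w x * Complex.normSq (f x) ∂μ : ℝ) : ℂ) := by
      rw [L2.inner_def, ← integral_complex_ofReal]
      refine integral_congr_ae ?_
      filter_upwards [hk] with x h1
      rw [h1, RCLike.inner_apply, mul_assoc, Complex.mul_conj, Complex.ofReal_mul]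
    rw [h1, Complex.ofReal_re]
    refine integral_nonneg_of_ae ?_
    filter_upwards [hae] with x hx using mul_nonneg (hw x hx) (Complex.normSq_nonneg _)
  have hpos : 0 < μ.real univ := by
    rw [measureReal_def]
    exact ENNReal.toReal_pos (by simpa using hμ0) (measure_ne_top _ _)
  let c : ℝ := (Real.sqrt (μ.real univ))⁻¹
  have hc : c * c * μ.real univ = 1 := by
    rw [← mul_inv, Real.mul_self_sqrt hpos.le, inv_mul_cancel₀ hpos.ne']
  let e : Lp ℂ 2 μ := (hmem (f := fun _ => (c : ℂ)) (by fun_prop) 2).toLp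
  have he : e =ᵐ[μ] fun _ => (c : ℂ) := MemLp.coeFn_toLp _
  have hen : ‖e‖ = 1 := by
    have h1 : inner ℂ e e = 1 := by
      rw [L2.inner_def]
      have : ∫ x, inner ℂ (e x) (e x) ∂μ = ∫ x, ((c * c : ℝ) : ℂ) ∂μ := by
        refine integral_congr_ae ?_
        filter_upwards [he] with x h1
        rw [h1, RCLike.inner_apply, Complex.conj_ofReal, Complex.ofReal_mul]
      rw [this, integral_const, Complex.real_smul, ← Complex.ofReal_mul, mul_comm, hc]
      simp
    have h2 : ‖e‖ ^ 2 = 1 := by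
      rw [← inner_self_eq_norm_sq (𝕜 := ℂ), h1]; simp
    exact (pow_eq_one_iff_of_nonneg (norm_nonneg e) two_ne_zero).1 h2
  obtain ⟨τ, a, hτ, hτ0, h⟩ := exists_schur_measure M hMs hpq
    (fun f => hre f _ (fun x => x - p) (fun x hx => sub_nonneg.2 hx.1) (by
      filter_upwards [Lp.coeFn_sub (M f) ((p : ℂ) • f), hM f, Lp.coeFn_smul (p : ℂ) f]
        with x h1 h2 h3
      rw [h1, Pi.sub_apply, h2, h3, Pi.smul_apply, smul_eq_mul]
      push_cast
      ring))
    (fun f => hre f _ (fun x => q - x) (fun x hx => sub_nonneg.2 hx.2) (by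
      filter_upwards [Lp.coeFn_sub ((q : ℂ) • f) (M f), hM f, Lp.coeFn_smul (q : ℂ) f]
        with x h1 h2 h3
      rw [h1, Pi.sub_apply, h2, h3, Pi.smul_apply, smul_eq_mul]
      push_cast
      ring)) e hen
  refine ⟨τ, a, hτ, hτ0, fun z hz => ?_⟩
  have hr := continuousOn_resolvent hz
  let v : Lp ℂ 2 μ := (hmem (f := fun x => c * (z - (x : ℂ))⁻¹) (by fun_prop) 2).toLp
  have hv : v =ᵐ[μ] fun x => c * (z - (x : ℂ))⁻¹ := MemLp.coeFn_toLp _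
  have hzv : z • v - M v = e := by
    refine Lp.ext ?_
    filter_upwards [Lp.coeFn_sub (z • v) (M v), hM v, Lp.coeFn_smul z v, hv, he, hae]
      with x h1 h2 h3 h4 h5 h6
    rw [h1, Pi.sub_apply, h2, h3, Pi.smul_apply, smul_eq_mul, h4, h5]
    have := sub_ofReal_ne_zero hz h6
    field_simp
  have hev : inner ℂ e v = c * c * ∫ x : ℝ, (z - (x : ℂ))⁻¹ ∂μ := by
    rw [L2.inner_def, ← integral_const_mul]
    refine integral_congr_ae ?_
    filter_upwards [he, hv] with x h1 h2
    rw [h1, h2, RCLike.inner_apply, Complex.conj_ofReal]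
    ring
  have h1 := h z hz v hzv
  have hc' : (c : ℂ) * c * (μ.real univ : ℂ) = 1 := by exact_mod_cast hc
  rw [hev] at h1
  linear_combination (μ.real univ : ℂ) * h1 - (∫ x : ℝ, (z - (x : ℂ))⁻¹ ∂μ) *
        (z - a - ∫ x : ℝ, (z - (x : ℂ))⁻¹ ∂τ) * hc'

namespace SignedM

theorem supp_eq (s : SignedM) : s.supp = s.pos.support ∪ s.neg.support := by
  rw [supp, msupport_eq_support, msupport_eq_support]

/-- The signed measure `-s`. -/
def swap (s : SignedM) : SignedM := ⟨s.neg, s.pos⟩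

theorem cauchy_swap (s : SignedM) (z : ℂ) : s.swap.cauchy z = -s.cauchy z := by
  simp [swap, cauchy, cintegral]

theorem supp_swap (s : SignedM) : s.swap.supp = s.supp := Set.union_comm _ _

theorem Carried.supp_subset {s : SignedM} {K : Set ℝ} (h : s.Carried K) : s.supp ⊆ K := by
  rw [supp_eq]
  exact Set.union_subset
    (Measure.support_subset_of_isClosed h.compact.isClosed (mem_ae_iff.2 h.posNull))
    (Measure.support_subset_of_isClosed h.compact.isClosed (mem_ae_iff.2 h.negNull))

theorem isClosed_supp {s : SignedM} : IsClosed s.supp := by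
  rw [supp_eq]
  exact Measure.isClosed_support.union Measure.isClosed_support

theorem Carried.exists_isM {s : SignedM} {p q : ℝ} (h : s.Carried (Icc p q))
    (hsign : s.pos = 0 ∨ s.neg = 0) (hinf : s.supp.Infinite) : ∃ Δ ⊆ Icc p q, IsM s Δ := by
  refine ⟨_, ?_, h.posFinite, h.negFinite, hsign,
    h.compact.of_isClosed_subset isClosed_supp h.supp_subset, hinf, rfl⟩
  exact Icc_subset_Icc (le_csInf hinf.nonempty fun x hx => (h.supp_subset hx).1)
    (csSup_le hinf.nonempty fun x hx => (h.supp_subset hx).2)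

end SignedM

namespace IsM

variable {s : SignedM} {Δ : Set ℝ}

theorem swap (h : IsM s Δ) : IsM s.swap Δ where
  posFinite := h.negFinite
  negFinite := h.posFinite
  constSign := h.constSign.symm
  compactSupp := by rw [SignedM.supp_swap]; exact h.compactSupp
  infiniteSupp := by rw [SignedM.supp_swap]; exact h.infiniteSupp
  hullEq := by rw [SignedM.supp_swap]; exact h.hullEq

theorem exists_eq_Icc (h : IsM s Δ) : ∃ p q : ℝ, p ≤ q ∧ Δ = Icc p q :=
  ⟨_, _, Real.sInf_le_sSup _ h.compactSupp.bddBelow h.compactSupp.bddAbove, h.hullEq⟩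

theorem isCompact (h : IsM s Δ) : IsCompact Δ := by
  rw [h.hullEq]; exact isCompact_Icc

theorem supp_subset (h : IsM s Δ) : s.supp ⊆ Δ := by
  rw [h.hullEq]
  exact fun x hx => ⟨csInf_le h.compactSupp.bddBelow hx, le_csSup h.compactSupp.bddAbove hx⟩

theorem carried (h : IsM s Δ) : s.Carried Δ where
  posFinite := h.posFinite
  negFinite := h.negFinite
  posNull := measure_mono_null (compl_subset_compl.2 ((Set.subset_union_left.trans_eq
    s.supp_eq.symm).trans h.supp_subset)) (Measure.measure_compl_support)
  negNull := measure_mono_null (compl_subset_compl.2 ((Set.subset_union_right.trans_eq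
    s.supp_eq.symm).trans h.supp_subset)) (Measure.measure_compl_support)
  compact := h.isCompact

theorem withDensityR (h : IsM s Δ) {g : ℝ → ℝ} (hg : ContinuousOn g Δ) (hg0 : ∀ x ∈ Δ, g x ≠ 0) :
    IsM (s.withDensityR g) Δ := by
  have hc := h.carried
  have hz {ν : Measure ℝ} (hν : ν Δᶜ = 0) {f : ℝ → ℝ} (hf : ∀ x ∈ Δ, f x < 0) :
      ν.withDensity (fun x => ENNReal.ofReal (f x)) = 0 := by
    rw [withDensity_congr_ae (g := 0), withDensity_zero]
    filter_upwards [mem_ae_iff.2 hν] with x hx using ENNReal.ofReal_of_nonpos (hf x hx).le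
  have hp {ν : Measure ℝ} [IsFiniteMeasure ν] (hν : ν Δᶜ = 0) {f : ℝ → ℝ}
      (hfc : ContinuousOn f Δ) (hf : ∀ x ∈ Δ, 0 < f x) :
      (ν.withDensity (fun x => ENNReal.ofReal (f x))).support = ν.support := by
    refine subset_antisymm (withDensity_absolutelyContinuous _ _).support_mono
      (withDensity_absolutelyContinuous' ?_ ?_).support_mono
    · exact (integrable_of_continuousOn_of_null
        h.isCompact hν hfc).aestronglyMeasurable.aemeasurable.ennreal_ofReal
    · filter_upwards [mem_ae_iff.2 hν] with x hx
      exact (ENNReal.ofReal_pos.2 (hf x hx)).ne'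
  have := h.posFinite
  have := h.negFinite
  have hconn : IsPreconnected Δ := by rw [h.hullEq]; exact isPreconnected_Icc
  have hkey : ((s.withDensityR g).pos = 0 ∨ (s.withDensityR g).neg = 0) ∧
      (s.withDensityR g).supp = s.supp := by
    by_cases hex : ∃ x ∈ Δ, 0 < g x
    · obtain ⟨x, hx, hgx⟩ := hex
      have hpos : ∀ y ∈ Δ, 0 < g y := by
        intro y hy
        by_contra hneg
        obtain ⟨t, ht, ht0⟩ := hconn.intermediate_value hy hx hg ⟨not_lt.1 hneg, hgx.le⟩
        exact hg0 t ht ht0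
      rw [SignedM.supp_eq, SignedM.supp_eq, ← hp hc.posNull hg hpos, ← hp hc.negNull hg hpos]
      simp only [SignedM.withDensityR]
      rw [hz hc.posNull (f := fun x => -g x) fun x hx => neg_lt_zero.2 (hpos x hx),
        hz hc.negNull (f := fun x => -g x) fun x hx => neg_lt_zero.2 (hpos x hx), add_zero,
        zero_add]
      exact ⟨h.constSign.imp (fun e => by simp [e]) (fun e => by simp [e]), rfl⟩
    · have hneg : ∀ y ∈ Δ, g y < 0 := fun y hy =>
        lt_of_le_of_ne (not_lt.1 fun hlt => hex ⟨y, hy, hlt⟩) (hg0 y hy)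
      have hpos : ∀ y ∈ Δ, 0 < -g y := fun y hy => neg_pos.2 (hneg y hy)
      rw [SignedM.supp_eq, SignedM.supp_eq, ← hp hc.posNull hg.neg hpos,
        ← hp hc.negNull hg.neg hpos]
      simp only [SignedM.withDensityR]
      rw [hz hc.posNull hneg, hz hc.negNull hneg, add_zero, zero_add]
      exact ⟨h.constSign.symm.imp (fun e => by simp [e]) (fun e => by simp [e]),
        Set.union_comm _ _⟩
  have hc' := hc.withDensityR hg
  refine ⟨hc'.posFinite, hc'.negFinite, hkey.1, ?_, ?_, ?_⟩ <;> rw [hkey.2]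
  exacts [h.compactSupp, h.infiniteSupp, h.hullEq]

end IsM

theorem SignedM.Carried.tendsto_total_of_mul {s t : SignedM} {K K' : Set ℝ} (hs : s.Carried K)
    (ht : t.Carried K') {g : ℝ → ℂ} {C : ℂ} (hg : Tendsto g atTop (nhds C))
    (h : ∀ᶠ r : ℝ in atTop, s.cauchy r = t.cauchy r * g r) : (s.total : ℂ) = t.total * C := by
  refine tendsto_nhds_unique hs.tendsto_mul_cauchy ((ht.tendsto_mul_cauchy.mul hg).congr' ?_)
  filter_upwards [h] with r hr
  rw [hr, mul_assoc]

theorem SignedM.Carried.total_mul_eq_one {s : SignedM} {K : Set ℝ} (hs : s.Carried K)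
    {g : ℝ → ℂ} {C α : ℂ} (hg : Tendsto g atTop (nhds C))
    (h : ∀ᶠ r : ℝ in atTop, s.cauchy r * (α * r + g r) = 1) : (s.total : ℂ) * α = 1 := by
  have h1 := (hs.tendsto_mul_cauchy.mul_const α).add (hs.tendsto_cauchy.mul hg)
  rw [zero_mul, add_zero] at h1
  refine tendsto_nhds_unique (h1.congr' ?_) tendsto_const_nhds
  filter_upwards [h] with r hr
  rw [← hr]
  ring

theorem exists_aeval_mul_cauchy_eq {s : SignedM} {K : Set ℝ} (hs : s.Carried K) (Q : ℝ[X]) :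
    ∃ R : ℝ[X], ∀ z ∉ cSet K, aeval z Q * s.cauchy z =
      s.cintegral (fun x => aeval (x : ℂ) Q * (z - x)⁻¹) + aeval z R := by
  induction Q using Polynomial.induction_on' with
  | add P Q hP hQ =>
    obtain ⟨R, hR⟩ := hP
    obtain ⟨S, hS⟩ := hQ
    refine ⟨R + S, fun z hz => ?_⟩
    have hr := continuousOn_resolvent hz
    simp only [map_add, add_mul]
    rw [hs.cintegral_add (by fun_prop) (by fun_prop), hR z hz, hS z hz]
    ring
  | monomial k c =>
    induction k with
    | zero =>
      refine ⟨0, fun z _ => ?_⟩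
      simp [SignedM.cauchy, ← SignedM.cintegral_const_mul]
    | succ k ih =>
      obtain ⟨R, hR⟩ := ih
      refine ⟨X * R + C (s.rintegral fun x => (monomial k c).eval x), fun z hz => ?_⟩
      have h1 := hs.cintegral_mul_resolvent (f := fun x : ℝ => aeval (x : ℂ) (monomial k c))
        (by fun_prop) hz
      have h2 : s.cintegral (fun x : ℝ => aeval (x : ℂ) (monomial k c)) =
          ((s.rintegral fun x => (monomial k c).eval x : ℝ) : ℂ) := by
        rw [← SignedM.cintegral_ofReal]
        simp
      have h3 (w : ℂ) : aeval w (monomial (k + 1) c) = w * aeval w (monomial k c) := by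
        simp only [aeval_monomial]
        ring
      simp only [h3]
      rw [h1, mul_assoc, hR z hz, h2]
      simp
      ring

theorem eq_zero_of_tendsto_aeval {R : ℝ[X]}
    (h : Tendsto (fun r : ℝ => aeval (r : ℂ) R) atTop (nhds 0)) : R = 0 := by
  have h1 : Tendsto (fun r : ℝ => R.eval r) atTop (nhds 0) := by
    have := (Complex.continuous_re.tendsto 0).comp h
    refine (this.congr fun r => ?_)
    rw [Function.comp_apply, ← Complex.coe_algebraMap, aeval_algebraMap_apply]
    simp
  exact leadingCoeff_eq_zero.1 ((Polynomial.tendsto_nhds_iff R).1 h1).1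

theorem aeval_ofReal_eq (Q : ℝ[X]) (x : ℝ) : aeval (x : ℂ) Q = ((Q.eval x : ℝ) : ℂ) := by
  rw [← Complex.coe_algebraMap, aeval_algebraMap_apply]
  simp

/-- The Cauchy transform of a measure with infinite support is not a rational function. -/
theorem IsM.eq_zero_of_aeval_mul_cauchy {s : SignedM} {Δ : Set ℝ} (h : IsM s Δ) {P Q : ℝ[X]}
    (hPQ : ∀ z ∉ cSet Δ, aeval z Q * s.cauchy z = aeval z P) : Q = 0 := by
  have hs := h.carried
  have hcau (A : ℝ[X]) (z : ℂ) (hz : z ∉ cSet Δ) : (s.withDensityR A.eval).cauchy z =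
      s.cintegral (fun x => aeval (x : ℂ) A * (z - x)⁻¹) := by
    rw [SignedM.cauchy, hs.cintegral_withDensityR A.continuous.continuousOn
      (continuousOn_resolvent hz)]
    simp only [aeval_ofReal_eq]
  have hlim (A : ℝ[X]) : Tendsto
      (fun r : ℝ => s.cintegral (fun x => aeval (x : ℂ) A * ((r : ℂ) - x)⁻¹)) atTop (nhds 0) := by
    refine (hs.withDensityR A.continuous.continuousOn).tendsto_cauchy.congr' ?_
    filter_upwards [hs.eventually_notMem] with r hr using hcau A r hr
  have h0 : ∀ z ∉ cSet Δ, s.cintegral (fun x => aeval (x : ℂ) Q * (z - x)⁻¹) = 0 := by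
    obtain ⟨R, hR⟩ := exists_aeval_mul_cauchy_eq hs Q
    have h1 : ∀ z ∉ cSet Δ,
        s.cintegral (fun x => aeval (x : ℂ) Q * (z - x)⁻¹) = aeval z (P - R) := fun z hz => by
      rw [map_sub, ← hPQ z hz, hR z hz, add_sub_cancel_right]
    have h2 : P - R = 0 := by
      refine eq_zero_of_tendsto_aeval ((hlim Q).congr' ?_)
      filter_upwards [hs.eventually_notMem] with r hr using h1 r hr
    intro z hz
    rw [h1 z hz, h2, map_zero]
  have hstep (A : ℝ[X]) (hA : ∀ z ∉ cSet Δ, s.cintegral (fun x => aeval (x : ℂ) A * (z - x)⁻¹) = 0) :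
      s.cintegral (fun x => aeval (x : ℂ) A) = 0 ∧
        ∀ z ∉ cSet Δ, s.cintegral (fun x => aeval (x : ℂ) (X * A) * (z - x)⁻¹) = 0 := by
    have h1 (z : ℂ) (hz : z ∉ cSet Δ) :
        s.cintegral (fun x => aeval (x : ℂ) (X * A) * (z - x)⁻¹) =
          -s.cintegral (fun x => aeval (x : ℂ) A) := by
      have := hs.cintegral_mul_resolvent (f := fun x : ℝ => aeval (x : ℂ) A) (by fun_prop) hz
      rw [hA z hz, mul_zero, zero_sub] at this
      simpa using this
    have h2 : -s.cintegral (fun x => aeval (x : ℂ) A) = 0 := by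
      refine tendsto_nhds_unique (tendsto_const_nhds.congr' ?_) (hlim (X * A))
      filter_upwards [hs.eventually_notMem] with r hr using (h1 r hr).symm
    exact ⟨neg_eq_zero.1 h2, fun z hz => (h1 z hz).trans h2⟩
  have hpow (k : ℕ) : ∀ z ∉ cSet Δ,
      s.cintegral (fun x => aeval (x : ℂ) (X ^ k * Q) * (z - x)⁻¹) = 0 := by
    induction k with
    | zero => simpa using h0
    | succ k ih =>
      rw [pow_succ', mul_assoc]
      exact (hstep _ ih).2
  have hmom (B : ℝ[X]) : s.cintegral (fun x => aeval (x : ℂ) (B * Q)) = 0 := by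
    induction B using Polynomial.induction_on' with
    | add A B hA hB =>
      simp only [add_mul, map_add]
      rw [hs.cintegral_add (by fun_prop) (by fun_prop), hA, hB, add_zero]
    | monomial k c =>
      have := (hstep _ (hpow k)).1
      simp only [← C_mul_X_pow_eq_monomial, mul_assoc, map_mul (aeval _) (C c)]
      simp only [aeval_C]
      rw [SignedM.cintegral_const_mul, this, mul_zero]
  by_contra hQ
  have hroots : {x : ℝ | Q.eval x = 0}.Finite := by
    refine (Q.roots.toFinset.finite_toSet).subset fun x hx => ?_
    simpa [hQ] using hx
  have hsq {ν : Measure ℝ} [IsFiniteMeasure ν] (hν : ν Δᶜ = 0)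
      (hint : ∫ x : ℝ, aeval (x : ℂ) (Q * Q) ∂ν = 0) : ν.support.Finite := by
    simp only [aeval_ofReal_eq, eval_mul] at hint
    rw [integral_complex_ofReal, Complex.ofReal_eq_zero, integral_eq_zero_iff_of_nonneg
      (fun x => mul_self_nonneg _)
      (integrable_of_continuousOn_of_null h.isCompact hν
        (Q.continuous.mul Q.continuous).continuousOn)] at hint
    refine hroots.subset (Measure.support_subset_of_isClosed hroots.isClosed ?_)
    filter_upwards [hint] with x hx using mul_self_eq_zero.1 hx
  have := h.posFinite
  have := h.negFinite
  have hzero := hmom Q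
  refine h.infiniteSupp ?_
  rw [SignedM.supp_eq]
  rw [SignedM.cintegral] at hzero
  rcases h.constSign with e | e
  · rw [e, integral_zero_measure, zero_sub, neg_eq_zero] at hzero
    simpa [e] using hsq hs.negNull hzero
  · rw [e, integral_zero_measure, sub_zero] at hzero
    simpa [e] using hsq hs.posNull hzero

theorem infinite_compl_cSet {K : Set ℝ} : (cSet K)ᶜ.Infinite := by
  refine Set.Infinite.mono (s := range fun t : ℕ => (t : ℂ) + Complex.I) ?_
    (Set.infinite_range_of_injective fun a b hab => by simpa using hab)
  rintro _ ⟨t, rfl⟩ ⟨x, -, hx⟩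
  simpa using congrArg Complex.im hx

theorem eq_zero_of_aeval_compl_cSet {K : Set ℝ} {P : ℝ[X]}
    (h : ∀ z ∉ cSet K, aeval z P = 0) : P = 0 := by
  have h1 : P.map (algebraMap ℝ ℂ) = 0 := by
    refine Polynomial.eq_zero_of_infinite_isRoot _ (infinite_compl_cSet (K := K) |>.mono ?_)
    intro z hz
    simpa [Polynomial.IsRoot, Polynomial.eval_map_algebraMap] using h z hz
  exact (Polynomial.map_eq_zero _).1 h1

/-- The inverse measure of `s ∈ M(Δ)`. -/
theorem IsM.exists_inverse {s : SignedM} {Δ : Set ℝ} (h : IsM s Δ) :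
    ∃ (τ : SignedM) (Δ' : Set ℝ) (α β : ℝ), Δ' ⊆ Δ ∧ IsM τ Δ' ∧ s.total * α = 1 ∧
      ∀ z ∉ cSet Δ, s.cauchy z * (α * z + β + τ.cauchy z) = 1 := by
  suffices H : ∀ {s : SignedM}, IsM s Δ → s.neg = 0 →
      ∃ (τ : SignedM) (Δ' : Set ℝ) (α β : ℝ), Δ' ⊆ Δ ∧ IsM τ Δ' ∧
      ∀ z ∉ cSet Δ, s.cauchy z * (α * z + β + τ.cauchy z) = 1 by
    have H' : ∃ (τ : SignedM) (Δ' : Set ℝ) (α β : ℝ), Δ' ⊆ Δ ∧ IsM τ Δ' ∧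
        ∀ z ∉ cSet Δ, s.cauchy z * (α * z + β + τ.cauchy z) = 1 := by
      rcases h.constSign with e | e
      · obtain ⟨τ, Δ', α, β, h1, h2, h3⟩ := H h.swap e
        refine ⟨τ.swap, Δ', -α, -β, h1, h2.swap, fun z hz => ?_⟩
        have := h3 z hz
        rw [SignedM.cauchy_swap] at this ⊢
        push_cast
        linear_combination this
      · exact H h e
    obtain ⟨τ, Δ', α, β, h1, h2, h3⟩ := H'
    refine ⟨τ, Δ', α, β, h1, h2, ?_, h3⟩
    have h4 := h.carried.total_mul_eq_one (α := α)
      (h2.carried.tendsto_cauchy.const_add (β : ℂ)) (by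
        filter_upwards [h.carried.eventually_notMem] with r hr
        rw [← h3 r hr, add_assoc])
    exact_mod_cast h4
  intro s h hneg
  obtain ⟨p, q, hpq, rfl⟩ := h.exists_eq_Icc
  have hs := h.carried
  have := h.posFinite
  have hμ0 : s.pos ≠ 0 := fun e => h.infiniteSupp (by simp [SignedM.supp_eq, e, hneg])
  obtain ⟨τ, a, hτ, hτ0, hinv⟩ := exists_inverse_measure s.pos hpq hs.posNull hμ0
  have hc : s.pos.real univ ≠ 0 := by
    rw [measureReal_def]
    exact (ENNReal.toReal_pos (by simpa using hμ0) (measure_ne_top _ _)).ne'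
  set c := s.pos.real univ
  have hcp : 0 < c := lt_of_le_of_ne measureReal_nonneg (Ne.symm hc)
  let t : SignedM := ⟨0, ENNReal.ofReal c⁻¹ • τ⟩
  have htc : t.Carried (Icc p q) := by
    refine ⟨inferInstanceAs (IsFiniteMeasure (0 : Measure ℝ)), ?_, by simp [t], by simp [t, hτ0],
      isCompact_Icc⟩
    exact Measure.smul_finite _ ENNReal.ofReal_ne_top
  have ht (z : ℂ) (hz : z ∉ cSet (Icc p q)) :
      s.cauchy z * (((c⁻¹ : ℝ) : ℂ) * z + ((-c⁻¹ * a : ℝ) : ℂ) + t.cauchy z) = 1 := by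
    have h1 := hinv z hz
    have h2 : s.cauchy z = ∫ x : ℝ, (z - (x : ℂ))⁻¹ ∂s.pos := by
      simp [SignedM.cauchy, SignedM.cintegral, hneg]
    have h3 : t.cauchy z = -((c⁻¹ : ℝ) : ℂ) * ∫ x : ℝ, (z - (x : ℂ))⁻¹ ∂τ := by
      simp [SignedM.cauchy, SignedM.cintegral, t, integral_smul_measure,
        ENNReal.toReal_ofReal (inv_nonneg.2 hcp.le)]
    have h4 : (c : ℂ) * ((c⁻¹ : ℝ) : ℂ) = 1 := by
      rw [← Complex.ofReal_mul, mul_inv_cancel₀ hc, Complex.ofReal_one]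
    rw [h2, h3]
    push_cast at h4 ⊢
    linear_combination (c : ℂ)⁻¹ * h1 + h4
  have hinf : t.supp.Infinite := by
    intro hfin
    let F : ℝ[X] := ∏ x ∈ hfin.toFinset, (X - C x)
    obtain ⟨R, hR⟩ := exists_aeval_mul_cauchy_eq htc F
    have hF (z : ℂ) : t.cintegral (fun x => aeval (x : ℂ) F * (z - x)⁻¹) = 0 := by
      have h1 : ∫ x : ℝ, aeval (x : ℂ) F * (z - x)⁻¹ ∂t.neg = 0 := by
        rw [← integral_zero ℝ ℂ (μ := t.neg)]
        refine integral_congr_ae ?_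
        filter_upwards [Measure.support_mem_ae (μ := t.neg)] with x hx
        have hx' : x ∈ t.supp := by rw [SignedM.supp_eq]; exact Or.inr hx
        have : F.eval x = 0 := by
          rw [eval_prod]
          exact Finset.prod_eq_zero (hfin.mem_toFinset.2 hx') (by simp)
        simp [aeval_ofReal_eq, this]
      rw [SignedM.cintegral, h1]
      simp [t]
    have hzero := h.eq_zero_of_aeval_mul_cauchy (P := F)
      (Q := (C c⁻¹ * X + C (-c⁻¹ * a)) * F + R) fun z hz => by
        have h1 := ht z hz
        have h2 := hR z hz
        rw [hF, zero_add] at h2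
        simp only [map_add, map_mul, aeval_C, aeval_X, Complex.coe_algebraMap]
        push_cast at h1 ⊢
        linear_combination (aeval z F) * h1 - s.cauchy z * h2
    have hF0 : F = 0 := by
      refine eq_zero_of_aeval_compl_cSet (K := Icc p q) fun z hz => ?_
      have h1 := ht z hz
      have h2 := hR z hz
      rw [hF, zero_add] at h2
      have h3 := congrArg (aeval z) hzero
      simp only [map_add, map_mul, aeval_C, aeval_X, Complex.coe_algebraMap, map_zero] at h3
      push_cast at h1 h3
      linear_combination -(aeval z F) * h1 + s.cauchy z * h2 + s.cauchy z * h3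
    exact (monic_prod_of_monic _ _ fun x _ => monic_X_sub_C x).ne_zero hF0
  obtain ⟨Δ', hsub, hM⟩ := htc.exists_isM (Or.inl rfl) hinf
  exact ⟨t, Δ', _, _, hsub, hM, ht⟩

theorem eqOn_of_im_ne_zero {K : Set ℝ} (hK : IsCompact K) {f g : ℂ → ℂ}
    (hf : ContinuousOn f (cSet K)ᶜ) (hg : ContinuousOn g (cSet K)ᶜ)
    (h : ∀ z : ℂ, z.im ≠ 0 → f z = g z) (z : ℂ) (hz : z ∉ cSet K) : f z = g z := by
  by_cases him : z.im = 0
  · have hnhds : (cSet K)ᶜ ∈ nhds z := (isClosed_cSet hK).isOpen_compl.mem_nhds hz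
    have hseq : Tendsto (fun r : ℝ => z + r * Complex.I) (nhdsWithin 0 {0}ᶜ) (nhds z) := by
      have : Continuous fun r : ℝ => z + r * Complex.I := by fun_prop
      simpa using (this.tendsto 0).mono_left nhdsWithin_le_nhds
    refine tendsto_nhds_unique (((hf.continuousAt hnhds).tendsto.comp hseq).congr' ?_)
      ((hg.continuousAt hnhds).tendsto.comp hseq)
    filter_upwards [self_mem_nhdsWithin] with r hr
    refine h _ ?_
    simpa [him] using hr
  · exact h z him

theorem notMem_cSet_of_im_ne_zero {K : Set ℝ} {z : ℂ} (hz : z.im ≠ 0) : z ∉ cSet K := by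
  rintro ⟨x, -, rfl⟩
  exact hz (Complex.ofReal_im x)

theorem ofReal_notMem_cSet {K K' : Set ℝ} (h : Disjoint K K') {x : ℝ} (hx : x ∈ K) :
    (x : ℂ) ∉ cSet K' := fun hx' => h.notMem_of_mem_left hx (ofReal_mem_cSet.1 hx')

namespace SignedM.Carried

variable {a b τ : SignedM} {K K' : Set ℝ}

theorem mono (h : a.Carried K) (hK : K ⊆ K') (hK' : IsCompact K') : a.Carried K' :=
  ⟨h.posFinite, h.negFinite, measure_mono_null (compl_subset_compl.2 hK) h.posNull,
    measure_mono_null (compl_subset_compl.2 hK) h.negNull, hK'⟩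

theorem continuousOn_cauchyR_of_disjoint (hb : b.Carried K') (h : Disjoint K K') :
    ContinuousOn b.cauchyR K :=
  hb.continuousOn_cauchyR.mono h.subset_compl_right

theorem continuousOn_cauchy_of_disjoint (hb : b.Carried K') (h : Disjoint K K') :
    ContinuousOn (fun x : ℝ => b.cauchy (x : ℂ)) K := by
  simp only [cauchy_ofReal]
  exact Complex.continuous_ofReal.comp_continuousOn (hb.continuousOn_cauchyR_of_disjoint h)

theorem nik (ha : a.Carried K) (hb : b.Carried K') (h : Disjoint K K') : (a.nik b).Carried K :=
  ha.withDensityR (hb.continuousOn_cauchyR_of_disjoint h)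

theorem cintegral_nik (ha : a.Carried K) (hb : b.Carried K') (h : Disjoint K K') {f : ℝ → ℂ}
    (hf : ContinuousOn f K) :
    (a.nik b).cintegral f = a.cintegral fun x => b.cauchy (x : ℂ) * f x := by
  simp only [cauchy_ofReal]
  exact ha.cintegral_withDensityR (hb.continuousOn_cauchyR_of_disjoint h) hf

theorem cauchy_nik (ha : a.Carried K) (hb : b.Carried K') (h : Disjoint K K') {z : ℂ}
    (hz : z ∉ cSet K) :
    (a.nik b).cauchy z = a.cintegral fun x => b.cauchy (x : ℂ) * (z - x)⁻¹ :=
  ha.cintegral_nik hb h (continuousOn_resolvent hz)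

theorem cauchy_nik_eq_divided_difference (ha : a.Carried K) (hb : b.Carried K')
    (h : Disjoint K K') {z : ℂ} (hz : z.im ≠ 0) :
    (a.nik b).cauchy z =
      b.cintegral fun t => (a.cauchy z - a.cauchy (t : ℂ)) * (z - t)⁻¹ := by
  have hzK : z ∉ cSet K := notMem_cSet_of_im_ne_zero hz
  have hzK' : z ∉ cSet K' := notMem_cSet_of_im_ne_zero hz
  rw [ha.cauchy_nik hb h hzK]
  have h1 : (fun x : ℝ => b.cauchy (x : ℂ) * (z - x)⁻¹) =
      fun x : ℝ => b.cintegral fun t => (z - (x : ℂ))⁻¹ * ((x : ℂ) - t)⁻¹ := by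
    funext x
    rw [cintegral_const_mul, mul_comm]
    rfl
  rw [h1, ha.cintegral_comm hb]
  · refine hb.cintegral_congr fun t ht => ?_
    have htK := ofReal_notMem_cSet h.symm ht
    rw [cauchy, cauchy, ← ha.cintegral_sub (continuousOn_resolvent hzK)
      (continuousOn_resolvent htK), mul_comm, ← cintegral_const_mul]
    refine ha.cintegral_congr fun x hx => ?_
    have e1 := sub_ofReal_ne_zero hzK hx
    have e2 := sub_ofReal_ne_zero htK hx
    have e3 := sub_ofReal_ne_zero hzK' ht
    have e4 : (x : ℂ) - t ≠ 0 := by rw [← neg_sub]; exact neg_ne_zero.2 e2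
    field_simp
    ring
  · refine ContinuousOn.mul ?_ ?_
    · exact ContinuousOn.inv₀ (by fun_prop) fun y hy => sub_ofReal_ne_zero hzK hy.1
    · refine ContinuousOn.inv₀ (by fun_prop) fun y hy => ?_
      exact sub_ofReal_ne_zero (ofReal_notMem_cSet h hy.1) hy.2

/-- If `D = c + κ â` has reciprocal `α z + β + τ̂(z)`, then
`κ ⟨a, b⟩^ = D (γ - ⟨τ, D b⟩^)` with `γ = -α |D b|`. -/
theorem cauchy_nik_eq_mul (ha : a.Carried K) (hτ : τ.Carried K) (hb : b.Carried K')
    (h : Disjoint K K') {c κ α β : ℝ}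
    (hD : ∀ z ∉ cSet K, (c + κ * a.cauchy z) * (α * z + β + τ.cauchy z) = 1)
    {z : ℂ} (hz : z ∉ cSet K) :
    κ * (a.nik b).cauchy z = (c + κ * a.cauchy z) *
      (-α * (b.withDensityR fun t => c + κ * a.cauchyR t).total -
        (τ.nik (b.withDensityR fun t => c + κ * a.cauchyR t)).cauchy z) := by
  have hDc : ContinuousOn (fun t => c + κ * a.cauchyR t) K' := by
    have := ha.continuousOn_cauchyR_of_disjoint h.symm
    fun_prop
  have hb' := hb.withDensityR hDc
  refine eqOn_of_im_ne_zero (f := fun z => κ * (a.nik b).cauchy z)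
    (g := fun z => (c + κ * a.cauchy z) *
      (-α * (b.withDensityR fun t => c + κ * a.cauchyR t).total -
        (τ.nik (b.withDensityR fun t => c + κ * a.cauchyR t)).cauchy z))
    ha.compact (continuousOn_const.mul (ha.nik hb h).continuousOn_cauchy)
    ?_ (fun w hw => ?_) z hz
  · have h1 := ha.continuousOn_cauchy
    have h2 := (hτ.nik hb' h).continuousOn_cauchy
    fun_prop
  have hwK : w ∉ cSet K := notMem_cSet_of_im_ne_zero hw
  have hwK' : w ∉ cSet K' := notMem_cSet_of_im_ne_zero hw
  have ca := ha.continuousOn_cauchy_of_disjoint h.symm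
  have cτ := hτ.continuousOn_cauchy_of_disjoint h.symm
  have cr := continuousOn_resolvent hwK'
  rw [ha.cauchy_nik_eq_divided_difference hb h hw, hτ.cauchy_nik_eq_divided_difference hb' h hw,
    ← cintegral_one, hb.cintegral_withDensityR hDc continuousOn_const,
    hb.cintegral_withDensityR hDc (by fun_prop), ← cintegral_const_mul, ← cintegral_const_mul]
  push_cast
  simp only [← cauchy_ofReal]
  rw [← hb.cintegral_sub (by fun_prop) (by fun_prop), ← cintegral_const_mul]
  refine hb.cintegral_congr fun t ht => ?_
  have e1 := hD w hwK
  have e2 := hD t (ofReal_notMem_cSet h.symm ht)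
  have e3 := sub_ofReal_ne_zero hwK' ht
  field_simp
  linear_combination (c + κ * a.cauchy t) * e1 - (c + κ * a.cauchy w) * e2

/-- Cauchy transforms of densities that factor through `t̂`. -/
theorem cintegral_mul_resolvent_of_factor {ι : Type*} (I : Finset ι) {t : SignedM}
    {r : ι → SignedM} (ha : a.Carried K) (ht : t.Carried K') (hr : ∀ i ∈ I, (r i).Carried K')
    (h : Disjoint K K') {G : ℝ → ℂ} {p q : ℝ} {d : ι → ℝ}
    (hG : ∀ x ∈ K, G x = t.cauchy x * (p * x + q + ∑ i ∈ I, d i * (r i).cauchy x))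
    {z : ℂ} (hz : z ∉ cSet K) :
    a.cintegral (fun x => G x * (z - x)⁻¹) =
      p * (z * (a.nik t).cauchy z - (a.nik t).total) + q * (a.nik t).cauchy z +
        ∑ i ∈ I, d i * ((a.nik t).nik (r i)).cauchy z := by
  have hs := ha.nik ht h
  have cz := continuousOn_resolvent hz
  have ct := ht.continuousOn_cauchy_of_disjoint h
  have h1 := hs.cintegral_mul_resolvent (f := fun _ => 1) continuousOn_const hz
  simp only [mul_one, one_mul] at h1
  rw [cintegral_one] at h1
  have h2 : (a.nik t).cauchy z = (a.nik t).cintegral fun x => (z - (x : ℂ))⁻¹ := rfl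
  have h3 (i : ι) (hi : i ∈ I) : (d i : ℂ) * ((a.nik t).nik (r i)).cauchy z =
      (a.nik t).cintegral fun x => d i * ((r i).cauchy x * (z - x)⁻¹) := by
    rw [hs.cauchy_nik (hr i hi) h hz, cintegral_const_mul]
  have h4 (i : ι) (hi : i ∈ I) : ContinuousOn (fun x : ℝ => (r i).cauchy (x : ℂ)) K :=
    (hr i hi).continuousOn_cauchy_of_disjoint h
  have h5 : ContinuousOn (fun x : ℝ => ∑ i ∈ I, d i * ((r i).cauchy x * (z - x)⁻¹)) K :=
    continuousOn_finsetSum _ fun i hi => continuousOn_const.mul ((h4 i hi).mul cz)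
  rw [Finset.sum_congr rfl h3, ← hs.cintegral_finset_sum I
    (fun i x => d i * ((r i).cauchy (x : ℂ) * (z - x)⁻¹)) fun i hi =>
    continuousOn_const.mul ((h4 i hi).mul cz), h2, ← h1, ← cintegral_const_mul,
    ← cintegral_const_mul, ← hs.cintegral_add (by fun_prop) (by fun_prop),
    ← hs.cintegral_add (by fun_prop) h5, ha.cintegral_nik ht h (by fun_prop)]
  refine ha.cintegral_congr fun x hx => ?_
  rw [hG x hx, mul_assoc, add_mul, Finset.sum_mul]
  simp only [mul_assoc]
  ring

end SignedM.Carried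

namespace IsM

variable {a b : SignedM} {Δ Δ' : Set ℝ}

theorem cauchy_ne_zero (h : IsM a Δ) {z : ℂ} (hz : z ∉ cSet Δ) : a.cauchy z ≠ 0 := by
  obtain ⟨τ, _, α, β, -, -, -, h1⟩ := h.exists_inverse
  exact left_ne_zero_of_mul_eq_one (h1 z hz)

theorem cauchyR_ne_zero (h : IsM a Δ) (hd : Disjoint Δ Δ') {x : ℝ} (hx : x ∈ Δ') :
    a.cauchyR x ≠ 0 := by
  have := h.cauchy_ne_zero (ofReal_notMem_cSet hd.symm hx)
  rwa [SignedM.cauchy_ofReal, Complex.ofReal_ne_zero] at this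

theorem nik (ha : IsM a Δ) (hb : IsM b Δ') (h : Disjoint Δ Δ') : IsM (a.nik b) Δ :=
  ha.withDensityR (hb.carried.continuousOn_cauchyR_of_disjoint h)
    fun _ hx => hb.cauchyR_ne_zero h.symm hx

/-- The quotient `â / ⟨a, b⟩^` is a constant plus the Cauchy transform of a measure on `Δ`. -/
theorem exists_cauchy_eq_nik_mul (ha : IsM a Δ) (hb : IsM b Δ') (h : Disjoint Δ Δ') :
    ∃ (τ : SignedM) (Δτ : Set ℝ) (C : ℝ), Δτ ⊆ Δ ∧ IsM τ Δτ ∧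
      ∀ z ∉ cSet Δ, a.cauchy z = (a.nik b).cauchy z * (C + τ.cauchy z) := by
  have hab := ha.nik hb h
  have hba := hb.nik ha h.symm
  obtain ⟨τb, Δb, αb, βb, hΔb, hτb, -, hinvb⟩ := hb.exists_inverse
  obtain ⟨τ, Δτ, α, β, hΔτ, hτ, htot, hinv⟩ := hab.exists_inverse
  have cτb : τb.Carried Δ' := hτb.carried.mono hΔb hb.isCompact
  have cτ : τ.Carried Δ := hτ.carried.mono hΔτ ha.isCompact
  have cR : ContinuousOn (fun x => (b.nik a).cauchyR x / b.cauchyR x) Δ :=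
    (hba.carried.continuousOn_cauchyR_of_disjoint h).div
      (hb.carried.continuousOn_cauchyR_of_disjoint h) fun x hx => hb.cauchyR_ne_zero h.symm hx
  have hγ := fun x (hx : x ∈ Δ) => hb.carried.cauchy_nik_eq_mul cτb ha.carried h.symm
    (c := 0) (κ := 1) (α := αb) (β := βb) (by simpa using hinvb) (ofReal_notMem_cSet h hx)
  simp only [zero_add, one_mul, Complex.ofReal_zero, Complex.ofReal_one] at hγ
  let γ : ℝ := -α * (τb.withDensityR fun t => (a.nik b).cauchyR t).total
  have hkey (z : ℂ) (hz : z ∉ cSet Δ) := hab.carried.cauchy_nik_eq_mul cτ cτb h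
    (c := 0) (κ := 1) (α := α) (β := β) (by simpa using hinv) hz
  simp only [zero_add, one_mul, Complex.ofReal_zero, Complex.ofReal_one] at hkey
  refine ⟨τ.withDensityR fun x => (b.nik a).cauchyR x / b.cauchyR x, Δτ,
    βb + γ - αb * (a.nik b).total * β, hΔτ,
    hτ.withDensityR (cR.mono hΔτ) fun x hx => div_ne_zero
      (hba.cauchyR_ne_zero h.symm (hΔτ hx)) (hb.cauchyR_ne_zero h.symm (hΔτ hx)), fun z hz => ?_⟩
  have h1 := ha.carried.cintegral_mul_resolvent_of_factor (G := fun _ => 1) {()} hb.carried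
    (r := fun _ => τb) (fun _ _ => cτb) h (p := αb) (q := βb) (d := fun _ => 1) (fun x hx => by
      rw [← hinvb x (ofReal_notMem_cSet h hx)]; simp) hz
  simp only [one_mul, Finset.sum_singleton, Complex.ofReal_one] at h1
  have cz := continuousOn_resolvent hz
  have h2 : (τ.nik (τb.withDensityR fun t => (a.nik b).cauchyR t)).cauchy z =
      -(αb * (a.nik b).total) * τ.cauchy z -
        (τ.withDensityR fun x => (b.nik a).cauchyR x / b.cauchyR x).cauchy z := by
    have cw := cτb.withDensityR (hab.carried.continuousOn_cauchyR_of_disjoint h.symm)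
    rw [cτ.cauchy_nik cw h hz, SignedM.cauchy, SignedM.cauchy, cτ.cintegral_withDensityR cR cz,
      ← SignedM.cintegral_const_mul, ← cτ.cintegral_sub
      (f := fun x : ℝ => -(αb * (a.nik b).total : ℂ) * (z - x)⁻¹)
      (g := fun x : ℝ => (((b.nik a).cauchyR x / b.cauchyR x : ℝ) : ℂ) * (z - x)⁻¹)
      (continuousOn_const.mul cz) ((Complex.continuous_ofReal.comp_continuousOn cR).mul cz)]
    refine cτ.cintegral_congr fun x hx => ?_
    have h3 := hγ x hx
    have h4 := hb.cauchy_ne_zero (ofReal_notMem_cSet h hx)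
    rw [Complex.ofReal_div, ← SignedM.cauchy_ofReal, ← SignedM.cauchy_ofReal, h3,
      mul_div_cancel_left₀ _ h4]
    change _ = _ - (-αb * ((a.nik b).total : ℂ) - (τb.nik (a.nik b)).cauchy x) * _
    change (τb.nik (a.nik b)).cauchy x * _ = _
    ring
  have h5 := hinv z hz
  have h6 : ((a.nik b).total : ℂ) * α = 1 := by exact_mod_cast htot
  have h7 : (γ : ℂ) = -α * ((τb.withDensityR fun t => (a.nik b).cauchyR t).total : ℂ) := by
    simp [γ]
  have h8 := hkey z hz
  rw [← h7, h2] at h8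
  change a.cauchy z = _ at h1
  rw [h1, h8]
  push_cast
  linear_combination (αb * (a.nik b).total : ℂ) * h5 -
    (a.nik b).cauchy z * αb * z * h6

end IsM

theorem nikSys_self (σ : ℕ → SignedM) (k : ℕ) : nikSys σ k k = σ k := by
  rw [nikSys, dif_neg (lt_irrefl k)]

theorem nikSys_of_lt (σ : ℕ → SignedM) {j k : ℕ} (h : j < k) :
    nikSys σ j k = (σ j).nik (nikSys σ (j + 1) k) := by
  rw [nikSys, dif_pos h]

theorem nikSys_congr {σ σ' : ℕ → SignedM} {j k : ℕ} (hjk : j ≤ k)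
    (h : ∀ i, j ≤ i → i ≤ k → σ i = σ' i) : nikSys σ j k = nikSys σ' j k := by
  induction hjk using Nat.decreasingInduction with
  | self => rw [nikSys_self, nikSys_self, h k le_rfl le_rfl]
  | of_succ j hj ih =>
    rw [nikSys_of_lt _ hj, nikSys_of_lt _ hj, h j le_rfl hj.le,
      ih fun i hi hik => h i (Nat.le_of_succ_le hi) hik]

/-- The measures `σ i`, `l ≤ i ≤ m`, generate a Nikishin system on the intervals `Δ i`. -/
structure IsNik (σ : ℕ → SignedM) (Δ : ℕ → Set ℝ) (l m : ℕ) : Prop where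
  isM : ∀ i, l ≤ i → i ≤ m → IsM (σ i) (Δ i)
  disjoint : ∀ i, l ≤ i → i + 1 ≤ m → Disjoint (Δ i) (Δ (i + 1))

namespace IsNik

variable {σ : ℕ → SignedM} {Δ : ℕ → Set ℝ} {l m : ℕ}

theorem tail (h : IsNik σ Δ l m) : IsNik σ Δ (l + 1) m :=
  ⟨fun i hi => h.isM i (Nat.le_of_succ_le hi), fun i hi => h.disjoint i (Nat.le_of_succ_le hi)⟩

theorem isM_nikSys (h : IsNik σ Δ l m) {k : ℕ} (hlk : l ≤ k) (hkm : k ≤ m) :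
    IsM (nikSys σ l k) (Δ l) := by
  induction hlk using Nat.decreasingInduction with
  | self => rw [nikSys_self]; exact h.isM k le_rfl hkm
  | of_succ j hj ih =>
    rw [nikSys_of_lt _ hj]
    exact (h.isM j le_rfl (by omega)).nik (ih h.tail) (h.disjoint j le_rfl (by omega))

end IsNik

namespace IsNik

variable {ρ : ℕ → SignedM} {Δ : ℕ → Set ℝ} {l m : ℕ}

theorem cintegral_withDensityR_nikSys (h : IsNik ρ Δ l m) {ρ' : ℕ → SignedM} {g : ℝ → ℝ}
    (hg : ContinuousOn g (Δ l)) (hl : ρ' l = (ρ l).withDensityR g)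
    (hρ' : ∀ i, l < i → ρ' i = ρ i) {k : ℕ} (hlk : l ≤ k) (hkm : k ≤ m) {f : ℝ → ℂ}
    (hf : ContinuousOn f (Δ l)) :
    (nikSys ρ' l k).cintegral f = ((nikSys ρ l k).withDensityR g).cintegral f := by
  obtain rfl | hlt := hlk.eq_or_lt
  · rw [nikSys_self, nikSys_self, hl]
  have hl' := (h.isM l le_rfl (hlk.trans hkm)).carried
  have ht := (h.tail.isM_nikSys hlt hkm).carried
  have hd := h.disjoint l le_rfl (by omega)
  have hc := ht.continuousOn_cauchy_of_disjoint hd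
  have hg' : ContinuousOn (fun x => (g x : ℂ)) (Δ l) :=
    Complex.continuous_ofReal.comp_continuousOn hg
  rw [nikSys_of_lt _ hlt, nikSys_of_lt _ hlt, hl,
    nikSys_congr (σ' := ρ) hlt fun i hi _ => hρ' i hi,
    (hl'.withDensityR hg).cintegral_nik ht hd hf,
    hl'.cintegral_withDensityR hg (f := fun x => _ * f x) (hc.mul hf),
    (hl'.nik ht hd).cintegral_withDensityR hg hf,
    hl'.cintegral_nik ht hd (f := fun x => g x * f x) (hg'.mul hf)]
  exact hl'.cintegral_congr fun x _ => mul_left_comm _ _ _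

/-- Prepending the reciprocal of `c + κ â` to a Nikishin system, and twisting its first measure,
gives a Nikishin system for which the products `⟨a, ρ, …⟩` are divisible by `c + κ â`. -/
theorem exists_prepend (h : IsNik ρ Δ (l + 1) m) {a τ : SignedM} {K Δτ : Set ℝ}
    (ha : a.Carried K) (hτ : IsM τ Δτ) (hΔτ : Δτ ⊆ K)
    (hd : l + 1 ≤ m → Disjoint K (Δ (l + 1))) {c κ α β : ℝ}
    (hD : ∀ z ∉ cSet K, (c + κ * a.cauchy z) * (α * z + β + τ.cauchy z) = 1) :
    ∃ (σ : ℕ → SignedM) (Δ' : ℕ → Set ℝ), IsNik σ Δ' l m ∧ Δ' l = Δτ ∧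
      (∀ i, l < i → Δ' i = Δ i) ∧ σ l = τ ∧
      ∀ k, l < k → k ≤ m → ∀ z ∉ cSet K,
        κ * (a.nik (nikSys ρ (l + 1) k)).cauchy z = (c + κ * a.cauchy z) *
          (-α * (nikSys σ (l + 1) k).total - (nikSys σ l k).cauchy z) := by
  let g : ℝ → ℝ := fun t => c + κ * a.cauchyR t
  let σ : ℕ → SignedM := fun i =>
    if i = l then τ else if i = l + 1 then (ρ i).withDensityR g else ρ i
  have hτK := hτ.carried.mono hΔτ ha.compact
  have hgc (hl : l + 1 ≤ m) : ContinuousOn g (Δ (l + 1)) := by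
    have := ha.continuousOn_cauchyR_of_disjoint (hd hl).symm
    fun_prop
  have hg0 (hl : l + 1 ≤ m) (x : ℝ) (hx : x ∈ Δ (l + 1)) : g x ≠ 0 := by
    have := left_ne_zero_of_mul_eq_one (hD x (ofReal_notMem_cSet (hd hl).symm hx))
    rw [SignedM.cauchy_ofReal] at this
    exact_mod_cast this
  have hσl : σ l = τ := by simp [σ]
  have hσ1 : σ (l + 1) = (ρ (l + 1)).withDensityR g := by simp [σ]
  have hσ2 (i : ℕ) (hi : l + 1 < i) : σ i = ρ i := by
    simp only [σ, if_neg (show i ≠ l by omega), if_neg hi.ne']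
  refine ⟨σ, Function.update Δ l Δτ, ⟨fun i hi him => ?_, fun i hi him => ?_⟩, by simp,
    fun i hi => Function.update_of_ne hi.ne' _ _, hσl, fun k hlk hkm z hz => ?_⟩
  · obtain rfl | hi := hi.eq_or_lt
    · simpa [hσl] using hτ
    rw [Function.update_of_ne hi.ne']
    obtain rfl | hi := (Nat.succ_le_of_lt hi).eq_or_lt
    · rw [Nat.succ_eq_add_one, hσ1]
      exact (h.isM _ le_rfl him).withDensityR (hgc him) (hg0 him)
    · rw [hσ2 i hi]
      exact h.isM i hi.le him
  · rw [Function.update_of_ne (show i + 1 ≠ l by omega)]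
    obtain rfl | hi := hi.eq_or_lt
    · simpa using (hd him).mono_left hΔτ
    · rw [Function.update_of_ne hi.ne']
      exact h.disjoint i hi him
  · have hl : l + 1 ≤ m := (Nat.succ_le_of_lt hlk).trans hkm
    have hr := (h.isM_nikSys hlk hkm).carried
    have hu : (nikSys σ (l + 1) k).Carried (Δ (l + 1)) := by
      obtain rfl | hlt := (Nat.succ_le_of_lt hlk).eq_or_lt
      · rw [nikSys_self, hσ1]
        exact (h.isM _ le_rfl hl).carried.withDensityR (hgc hl)
      · rw [nikSys_of_lt _ hlt, nikSys_congr (σ' := ρ) hlt fun i hi _ => hσ2 i hi, hσ1]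
        exact ((h.isM _ le_rfl hl).carried.withDensityR (hgc hl)).nik
          (h.tail.isM_nikSys hlt hkm).carried (h.disjoint _ le_rfl (by omega))
    have hint {f : ℝ → ℂ} (hf : ContinuousOn f (Δ (l + 1))) :=
      h.cintegral_withDensityR_nikSys (hgc hl) hσ1 hσ2 hlk hkm hf
    rw [ha.cauchy_nik_eq_mul hτK hr (hd hl) hD hz, nikSys_of_lt _ hlk, hσl,
      hτK.cauchy_nik hu (hd hl) hz, hτK.cauchy_nik (hr.withDensityR (hgc hl)) (hd hl) hz,
      ← SignedM.cintegral_one, ← SignedM.cintegral_one, ← hint continuousOn_const]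
    congr 2
    refine hτK.cintegral_congr fun x hx => ?_
    congr 1
    exact (hint (continuousOn_resolvent (ofReal_notMem_cSet (hd hl) hx))).symm

end IsNik

theorem sum_Icc_eq_add_sum_Icc_succ {l m : ℕ} (h : l ≤ m) (f : ℕ → ℂ) :
    ∑ i ∈ Finset.Icc l m, f i = f l + ∑ i ∈ Finset.Icc (l + 1) m, f i := by
  rw [← Finset.insert_Icc_succ_left_eq_Icc h, Finset.sum_insert (by simp)]
  rfl

theorem bijOn_update_succ {e : ℕ → ℕ} {l m j : ℕ} (hlj : l < j) (hjm : j ≤ m)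
    (he : BijOn e (Icc (l + 2) m) (Icc (l + 1) m \ {j})) :
    BijOn (Function.update e (l + 1) l) (Icc (l + 1) m) (Icc l m \ {j}) := by
  have h1 : insert (l + 1) (Icc (l + 2) m) = Icc (l + 1) m :=
    insert_Icc_succ_left_eq_Icc (by omega)
  have h2 : insert l (Icc (l + 1) m \ {j}) = Icc l m \ {j} := by
    ext x; simp only [mem_insert_iff, Set.mem_sdiff, mem_Icc, mem_singleton_iff]; omega
  have h3 : BijOn (Function.update e (l + 1) l) (Icc (l + 2) m) (Icc (l + 1) m \ {j}) :=
    he.congr fun x hx => (Function.update_of_ne (by have := hx.1; omega) _ _).symm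
  have h4 := h3.insert (a := l + 1) (by simp)
  rwa [Function.update_self, h1, h2] at h4

theorem SignedM.tendsto_add_sum_cauchy {I : Finset ℕ} {r : ℕ → SignedM} {K : ℕ → Set ℝ}
    (hr : ∀ i ∈ I, (r i).Carried (K i)) (q : ℝ) (d : ℕ → ℝ) :
    Tendsto (fun x : ℝ => (q : ℂ) + ∑ i ∈ I, d i * (r i).cauchy x) atTop (nhds q) := by
  have := tendsto_finsetSum I fun i hi => (hr i hi).tendsto_cauchy.const_mul (d i : ℂ)
  simpa using this.const_add (q : ℂ)

/-- A Nikishin system generated by `meas` through which `1` and the Cauchy transforms of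
`nikSys σ (l + 1) k` factor, after division by that of `nikSys σ (l + 1) j`. The bijection `e`
matches the new Cauchy transforms with the old functions other than the `j`-th one (index `l`
standing for the constant `1`); the coefficients respect the degrees `n`. -/
structure Factorization (σ : ℕ → SignedM) (Δ : ℕ → Set ℝ) (l m j : ℕ) (n : ℕ → ℕ) where
  meas : ℕ → SignedM
  itv : ℕ → Set ℝ
  e : ℕ → ℕ
  a : ℝ
  b : ℝ
  const : ℕ → ℝ
  c : ℕ → ℕ → ℝ
  isNik : IsNik meas itv (l + 1) m
  itv_subset : ∀ i, l < i → i ≤ m → itv i ⊆ Δ i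
  bijOn : BijOn e (Icc (l + 1) m) (Icc l m \ {j})
  le_of_ne_zero : ∀ i k, l < i → i ≤ m → l ≤ k → k ≤ m → k ≠ j → c i k ≠ 0 → n k ≤ n (e i)
  one_eq : ∀ z ∉ cSet (Δ (l + 1)), 1 = (nikSys σ (l + 1) j).cauchy z *
    (a * z + b + ∑ i ∈ Finset.Icc (l + 1) m, c i l * (nikSys meas (l + 1) i).cauchy z)
  cauchy_eq : ∀ k, l < k → k ≤ m → k ≠ j → ∀ z ∉ cSet (Δ (l + 1)),
    (nikSys σ (l + 1) k).cauchy z = (nikSys σ (l + 1) j).cauchy z *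
      (const k + ∑ i ∈ Finset.Icc (l + 1) m, c i k * (nikSys meas (l + 1) i).cauchy z)

namespace Factorization

variable {σ : ℕ → SignedM} {Δ : ℕ → Set ℝ} {l m j : ℕ} {n : ℕ → ℕ}

theorem nonempty_of_head (h : IsNik σ Δ (l + 1) m) (hlm : l < m) :
    Nonempty (Factorization σ Δ l m (l + 1) n) := by
  have h1 := h.isM (l + 1) le_rfl hlm
  obtain ⟨τ, Δτ, α, β, hΔτ, hτ, -, hinv⟩ := h1.exists_inverse
  obtain ⟨σ', Δ', hσ', hΔ1, hΔ2, hσ1, hσk⟩ := h.tail.exists_prepend h1.carried hτ hΔτ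
    (h.disjoint _ le_rfl) (c := 0) (κ := 1) (α := α) (β := β) (by simpa using hinv)
  refine ⟨⟨σ', Δ', Function.update id (l + 1) l, α, β,
    fun k => -α * (nikSys σ' (l + 2) k).total,
    fun i k => if k = l then if i = l + 1 then 1 else 0 else if i = k then -1 else 0,
    hσ', fun i hi him => ?_, ?_, fun i k hi him hk hkm hkj hc => ?_, fun z hz => ?_,
    fun k hk hkm hkj z hz => ?_⟩⟩
  · obtain rfl | hi := (Nat.succ_le_of_lt hi).eq_or_lt
    · exact hΔ1.trans_subset hΔτ
    · exact (hΔ2 i hi).subset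
  · refine bijOn_update_succ (by omega) (by omega) ?_
    convert bijOn_id (Icc (l + 2) m) using 1
    ext x; simp only [Set.mem_sdiff, mem_Icc, mem_singleton_iff]; omega
  · obtain rfl | hkl := eq_or_ne k l
    · have : i = k + 1 := by by_contra hi'; simp [hi'] at hc
      simp [this]
    · have : i = k := by by_contra hi'; simp [hi', hkl] at hc
      rw [this, Function.update_of_ne hkj, id]
  · have := hinv z hz
    rw [sum_Icc_eq_add_sum_Icc_succ hlm, nikSys_self, nikSys_self, hσ1, Finset.sum_eq_zero]
    · simpa using this.symm
    · intro i hi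
      have : i ≠ l + 1 := by have := (Finset.mem_Icc.1 hi).1; omega
      simp [this]
  · have hk' : l + 1 < k := by omega
    have h2 := hσk k hk' hkm z hz
    rw [nikSys_self, nikSys_of_lt _ hk']
    simp only [Complex.ofReal_one, Complex.ofReal_zero, one_mul, zero_add] at h2
    rw [h2]
    simp only [if_neg hk.ne']
    rw [Finset.sum_eq_single k (fun i _ hik => by simp [hik])
      (fun hk'' => absurd (Finset.mem_Icc.2 ⟨hk, hkm⟩) hk'')]
    simp [sub_eq_add_neg]

theorem nonempty_of_le (h : IsNik σ Δ (l + 1) m) (hlj : l + 1 < j) (hjm : j ≤ m)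
    (hn : n (l + 1) ≤ n l) (F : Factorization σ Δ (l + 1) m j n) :
    Nonempty (Factorization σ Δ l m j n) := by
  have hlm : l + 1 < m := hlj.trans_le hjm
  have hρ : IsNik F.meas F.itv (l + 2) m := F.isNik
  have h1 := h.isM (l + 1) le_rfl hlm.le
  have ht := (h.tail.isM_nikSys hlj hjm).carried
  have hd := h.disjoint (l + 1) le_rfl hlm
  have hs := h.isM_nikSys hlj.le hjm
  obtain ⟨τ, Δτ, α, β, hΔτ, hτ, hα, hinv⟩ := hs.exists_inverse
  have hsj : nikSys σ (l + 1) j = (σ (l + 1)).nik (nikSys σ (l + 2) j) := nikSys_of_lt σ hlj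
  obtain ⟨σ', Δ', hσ', hΔ1, hΔ2, hσ1, hσk⟩ := hρ.exists_prepend hs.carried hτ hΔτ
    (fun hl => hd.mono_right (F.itv_subset _ (Nat.lt_succ_self _) hl))
    (c := 0) (κ := 1) (α := α) (β := β) (by simpa using hinv)
  have hr : ∀ i ∈ Finset.Icc (l + 2) m, (nikSys F.meas (l + 2) i).Carried (Δ (l + 2)) :=
    fun i hi => (hρ.isM_nikSys (Finset.mem_Icc.1 hi).1 (Finset.mem_Icc.1 hi).2).carried.mono
      (F.itv_subset _ (Nat.lt_succ_self _) hlm) ht.compact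
  let γ : ℕ → ℝ := fun i => -α * (nikSys σ' (l + 2) i).total
  have hγ (i : ℕ) (hi : i ∈ Finset.Icc (l + 2) m) (z : ℂ) (hz : z ∉ cSet (Δ (l + 1))) :
      ((nikSys σ (l + 1) j).nik (nikSys F.meas (l + 2) i)).cauchy z =
        (nikSys σ (l + 1) j).cauchy z * (γ i - (nikSys σ' (l + 1) i).cauchy z) := by
    have := hσk i (Finset.mem_Icc.1 hi).1 (Finset.mem_Icc.1 hi).2 z hz
    simpa [γ] using this
  have hne (i : ℕ) (hi : i ∈ Finset.Icc (l + 2) m) : i ≠ l + 1 := by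
    have := (Finset.mem_Icc.1 hi).1; omega
  let A : ℝ := F.a * (nikSys σ (l + 1) j).total
  refine ⟨⟨σ', Δ', Function.update F.e (l + 1) l, α, β,
    fun k => (if k = l + 1 then F.b - A * β else F.const k) +
      ∑ i ∈ Finset.Icc (l + 2) m, F.c i k * γ i,
    fun i k => if k = l then if i = l + 1 then 1 else 0 else
      if i = l + 1 then if k = l + 1 then -A else 0 else -F.c i k,
    hσ', fun i hi him => ?_, bijOn_update_succ (by omega) hjm F.bijOn,
    fun i k hi him hk hkm hkj hc => ?_, fun z hz => ?_, fun k hk hkm hkj z hz => ?_⟩⟩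
  · obtain rfl | hi := (Nat.succ_le_of_lt hi).eq_or_lt
    · exact hΔ1.trans_subset hΔτ
    · exact (hΔ2 i hi).trans_subset (F.itv_subset i hi him)
  · obtain rfl | hkl := eq_or_ne k l
    · have : i = k + 1 := by by_contra hi'; simp [hi'] at hc
      simp [this]
    · obtain rfl | hil := eq_or_ne i (l + 1)
      · have : k = l + 1 := by by_contra hi'; simp [hi', hkl] at hc
        simpa [this] using hn
      · rw [Function.update_of_ne hil]
        exact F.le_of_ne_zero i k (by omega) him (by omega) hkm hkj
          (by simpa [hkl, hil] using hc)
  · have := hinv z hz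
    rw [sum_Icc_eq_add_sum_Icc_succ hlm.le, nikSys_self, hσ1, Finset.sum_eq_zero]
    · simpa using this.symm
    · intro i hi
      simp [hne i hi]
  · have hfac {G : ℝ → ℂ} {p q : ℝ} {d : ℕ → ℝ} (hG : ∀ x ∈ Δ (l + 1), G x =
        (nikSys σ (l + 2) j).cauchy x * (p * x + q + ∑ i ∈ Finset.Icc (l + 2) m,
          d i * (nikSys F.meas (l + 2) i).cauchy x)) :
        (σ (l + 1)).cintegral (fun x => G x * (z - x)⁻¹) =
          p * (z * (nikSys σ (l + 1) j).cauchy z - (nikSys σ (l + 1) j).total) +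
          q * (nikSys σ (l + 1) j).cauchy z + (nikSys σ (l + 1) j).cauchy z *
            (∑ i ∈ Finset.Icc (l + 2) m, d i * γ i -
              ∑ i ∈ Finset.Icc (l + 2) m, d i * (nikSys σ' (l + 1) i).cauchy z) := by
      rw [h1.carried.cintegral_mul_resolvent_of_factor _ ht hr hd hG hz, ← hsj,
        Complex.ofReal_sum, ← Finset.sum_sub_distrib, Finset.mul_sum]
      congr 1
      refine Finset.sum_congr rfl fun i hi => ?_
      rw [hγ i hi z hz, Complex.ofReal_mul (d i)]
      ring
    rw [sum_Icc_eq_add_sum_Icc_succ hlm.le, Finset.sum_congr rfl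
      (g := fun i => -(F.c i k * (nikSys σ' (l + 1) i).cauchy z))
      fun i hi => by simp [hne i hi, hk.ne'], Finset.sum_neg_distrib, nikSys_self σ', hσ1]
    obtain rfl | hk := (Nat.succ_le_of_lt hk).eq_or_lt
    · have h2 := hfac (G := fun _ => 1) fun x hx =>
        F.one_eq x (ofReal_notMem_cSet hd hx)
      simp only [one_mul] at h2
      change (nikSys σ (l + 1) (l + 1)).cauchy z = _
      rw [nikSys_self]
      change (σ (l + 1)).cauchy z = _ at h2
      have h3 : ((nikSys σ (l + 1) j).total : ℂ) * α = 1 := by exact_mod_cast hα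
      rw [h2]
      simp [A]
      linear_combination (F.a * (nikSys σ (l + 1) j).total : ℂ) * hinv z hz -
        F.a * z * (nikSys σ (l + 1) j).cauchy z * h3
    · have h2 := hfac (p := 0) (q := F.const k) (d := fun i => F.c i k) fun x hx =>
        (F.cauchy_eq k hk hkm hkj x (ofReal_notMem_cSet hd hx)).trans (by simp)
      have hk2 : l + 1 < k := hk
      rw [nikSys_of_lt _ hk2, h1.carried.cauchy_nik (h.tail.isM_nikSys hk hkm).carried hd hz]
      refine h2.trans ?_
      simp [hk2.ne', (show k ≠ l by omega)]
      ring

end Factorization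

theorem Factorization.nonempty_of_lt {σ : ℕ → SignedM} {Δ : ℕ → Set ℝ} {l m j : ℕ} {n : ℕ → ℕ}
    (h : IsNik σ Δ (l + 1) m) (hlj : l + 1 < j) (hjm : j ≤ m) (hn : n l ≤ n (l + 1))
    (H : ∀ σ' Δ', IsNik σ' Δ' (l + 2) m →
      Nonempty (Factorization σ' Δ' (l + 1) m j (Function.update n (l + 1) (n l)))) :
    Nonempty (Factorization σ Δ l m j n) := by
  have hlm : l + 1 < m := hlj.trans_le hjm
  have h1 := h.isM (l + 1) le_rfl hlm.le
  have hd := h.disjoint (l + 1) le_rfl hlm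
  have ht := h.tail.isM_nikSys hlj hjm
  obtain ⟨τ₀, Δ₀, α₀, β₀, hΔ₀, hτ₀, -, hinv₀⟩ := h1.exists_inverse
  obtain ⟨σ₀, Δ₁, hσ₀, hΔ₁l, hΔ₁, hσ₀l, hσ₀k⟩ := h.tail.exists_prepend h1.carried hτ₀ hΔ₀
    (fun _ => hd) (c := 0) (κ := 1) (α := α₀) (β := β₀) (by simpa using hinv₀)
  obtain ⟨F⟩ := H σ₀ Δ₁ hσ₀.tail
  have hρ : IsNik F.meas F.itv (l + 2) m := F.isNik
  obtain ⟨τ, Δτ, w, hΔτ, hτ, hw⟩ := h1.exists_cauchy_eq_nik_mul ht hd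
  rw [← nikSys_of_lt σ hlj] at hw
  let γ : ℕ → ℝ := fun k => -α₀ * (nikSys σ₀ (l + 2) k).total
  have hγ (k : ℕ) (hk : l + 1 < k) (hkm : k ≤ m) (z : ℂ) (hz : z ∉ cSet (Δ (l + 1))) :
      (nikSys σ (l + 1) k).cauchy z =
        (σ (l + 1)).cauchy z * (γ k - (nikSys σ₀ (l + 1) k).cauchy z) := by
    have := hσ₀k k hk hkm z hz
    rw [nikSys_of_lt σ hk]
    simpa [γ] using this
  have hD (z : ℂ) (hz : z ∉ cSet (Δ (l + 1))) :
      (γ j - (nikSys σ₀ (l + 1) j).cauchy z) * (w + τ.cauchy z) = 1 := by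
    have e1 := hw z hz
    rw [hγ j hlj hjm z hz, mul_assoc] at e1
    exact mul_left_cancel₀ (h1.cauchy_ne_zero hz) (by rw [mul_one, ← e1])
  have hs₀ : (nikSys σ₀ (l + 1) j).Carried (Δ (l + 1)) :=
    (hσ₀.isM_nikSys hlj.le hjm).carried.mono (hΔ₁l.trans_subset hΔ₀) h1.isCompact
  have hsub : F.itv (l + 2) ⊆ Δ (l + 2) :=
    (F.itv_subset _ (Nat.lt_succ_self _) hlm).trans_eq (hΔ₁ _ (Nat.lt_succ_self _))
  obtain ⟨σ', Δ', hσ', hΔ1, hΔ2, hσ1, hσk⟩ := hρ.exists_prepend hs₀ hτ hΔτ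
    (fun _ => hd.mono_right hsub) (c := γ j) (κ := -1) (α := 0) (β := w)
    (fun z hz => by rw [← hD z hz]; push_cast; ring)
  have hΔ₁2 : Δ₁ (l + 2) = Δ (l + 2) := hΔ₁ _ (Nat.lt_succ_self _)
  have hr : ∀ i ∈ Finset.Icc (l + 2) m, (nikSys F.meas (l + 2) i).Carried (Δ (l + 2)) :=
    fun i hi => (hρ.isM_nikSys (Finset.mem_Icc.1 hi).1 (Finset.mem_Icc.1 hi).2).carried.mono
      hsub ht.isCompact
  have ht₀ (k : ℕ) (hk : l + 1 < k) (hkm : k ≤ m) :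
      (nikSys σ₀ (l + 2) k).Carried (Δ (l + 2)) := by
    rw [← hΔ₁2]
    exact (hσ₀.tail.isM_nikSys hk hkm).carried
  have hone (x : ℂ) (hx : x ∉ cSet (Δ (l + 2))) := F.one_eq x (by rwa [hΔ₁2])
  have hcau (k : ℕ) (hk : l + 1 < k) (hkm : k ≤ m) (hkj : k ≠ j) (x : ℂ)
      (hx : x ∉ cSet (Δ (l + 2))) := F.cauchy_eq k hk hkm hkj x (by rwa [hΔ₁2])
  have hγ0 : (α₀ : ℂ) + F.a * γ j = 0 := by
    have := (ht₀ j hlj hjm).total_mul_eq_one (α := F.a)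
      (SignedM.tendsto_add_sum_cauchy hr F.b fun i => F.c i (l + 1)) <| by
        filter_upwards [(ht₀ j hlj hjm).eventually_notMem] with x hx
        rw [← add_assoc]
        exact (hone x hx).symm
    simp only [γ]
    push_cast
    linear_combination -α₀ * this
  have hγC (k : ℕ) (hk : l + 1 < k) (hkm : k ≤ m) (hkj : k ≠ j) :
      (γ k : ℂ) = F.const k * γ j := by
    have := (ht₀ k hk hkm).tendsto_total_of_mul (ht₀ j hlj hjm)
      (SignedM.tendsto_add_sum_cauchy hr (F.const k) fun i => F.c i k) <| by
        filter_upwards [(ht₀ j hlj hjm).eventually_notMem] with x hx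
        exact hcau k hk hkm hkj x hx
    simp only [γ]
    push_cast
    linear_combination -α₀ * this
  have hfac {z : ℂ} (hz : z ∉ cSet (Δ (l + 1))) {G : ℝ → ℂ} {p q : ℝ} {d : ℕ → ℝ}
      (hG : ∀ x ∈ Δ (l + 1), G x =
        (nikSys σ₀ (l + 2) j).cauchy x * (p * x + q + ∑ i ∈ Finset.Icc (l + 2) m,
          d i * (nikSys F.meas (l + 2) i).cauchy x)) :
      τ₀.cintegral (fun x => G x * (z - x)⁻¹) =
        p * (z * (nikSys σ₀ (l + 1) j).cauchy z - (nikSys σ₀ (l + 1) j).total) +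
        q * (nikSys σ₀ (l + 1) j).cauchy z + (γ j - (nikSys σ₀ (l + 1) j).cauchy z) *
          ∑ i ∈ Finset.Icc (l + 2) m, d i * (nikSys σ' (l + 1) i).cauchy z := by
    have hsj : nikSys σ₀ (l + 1) j = τ₀.nik (nikSys σ₀ (l + 2) j) := by
      rw [nikSys_of_lt σ₀ hlj, hσ₀l]
    rw [(hτ₀.carried.mono hΔ₀ h1.isCompact).cintegral_mul_resolvent_of_factor _ (ht₀ j hlj hjm)
      hr hd hG hz, ← hsj, Finset.mul_sum]
    congr 1
    refine Finset.sum_congr rfl fun i hi => ?_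
    have := hσk i (Finset.mem_Icc.1 hi).1 (Finset.mem_Icc.1 hi).2 z hz
    push_cast at this
    linear_combination -d i * this
  let δ : ℝ := β₀ + F.b * γ j - F.a * (nikSys σ₀ (l + 1) j).total
  have hne (i : ℕ) (hi : i ∈ Finset.Icc (l + 2) m) : i ≠ l + 1 := by
    have := (Finset.mem_Icc.1 hi).1; omega
  have hupd (x : ℕ) (hx : l + 1 ≤ x) :
      Function.update n (l + 1) (n l) x = n (Equiv.swap l (l + 1) x) := by
    obtain rfl | hx' := eq_or_ne x (l + 1)
    · simp
    · rw [Function.update_of_ne hx', Equiv.swap_apply_of_ne_of_ne (by omega) hx']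
  refine ⟨⟨σ', Δ', Equiv.swap l (l + 1) ∘ Function.update F.e (l + 1) l, -F.a, δ * w - F.b,
    fun k => if k = l + 1 then w else F.const k,
    fun i k => if k = l then if i = l + 1 then δ else F.c i (l + 1) else
      if i = l + 1 then if k = l + 1 then 1 else 0 else if k = l + 1 then 0 else -F.c i k,
    hσ', fun i hi him => ?_, BijOn.comp (t := Icc l m \ {j}) ?_
      (bijOn_update_succ (by omega) hjm F.bijOn),
    fun i k hi him hk hkm hkj hc => ?_, fun z hz => ?_, fun k hk hkm hkj z hz => ?_⟩⟩
  · obtain rfl | hi := (Nat.succ_le_of_lt hi).eq_or_lt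
    · exact hΔ1.trans_subset hΔτ
    · exact (hΔ2 i hi).trans_subset ((F.itv_subset i hi him).trans_eq (hΔ₁ i hi))
  · have hmaps : MapsTo (Equiv.swap l (l + 1)) (Icc l m \ {j}) (Icc l m \ {j}) := by
      intro x hx
      simp only [Set.mem_sdiff, mem_Icc, mem_singleton_iff, Equiv.swap_apply_def] at hx ⊢
      split_ifs <;> omega
    exact ⟨hmaps, (Equiv.injective _).injOn, fun x hx => ⟨_, hmaps hx, Equiv.swap_apply_self _ _ _⟩⟩
  · rw [Function.comp_apply]
    obtain rfl | hil := eq_or_ne i (l + 1)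
    · simp only [Function.update_self, Equiv.swap_apply_left]
      obtain rfl | hkl := eq_or_ne k l
      · exact hn
      · have : k = l + 1 := by by_contra hi'; simp [hi', hkl] at hc
        rw [this]
    · rw [Function.update_of_ne hil]
      have hi2 : l + 1 < i := by omega
      have he : l + 1 ≤ F.e i := (F.bijOn.mapsTo ⟨hi2, him⟩).1.1
      rw [← hupd _ he]
      obtain rfl | hkl := eq_or_ne k l
      · simpa using F.le_of_ne_zero i (k + 1) hi2 him le_rfl hlm.le hlj.ne
          (by simpa [hil] using hc)
      · have hk1 : k ≠ l + 1 := by rintro rfl; simp [hil] at hc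
        have := F.le_of_ne_zero i k hi2 him (by omega) hkm hkj
          (by simpa [hil, hkl, hk1] using hc)
        rwa [Function.update_of_ne hk1] at this
  · have h2 := hfac hz (G := fun _ => 1) fun x hx => hone x (ofReal_notMem_cSet hd hx)
    simp only [one_mul] at h2
    change τ₀.cauchy z = _ at h2
    rw [sum_Icc_eq_add_sum_Icc_succ hlm.le, nikSys_self, hσ1, Finset.sum_congr rfl
      (g := fun i => F.c i (l + 1) * (nikSys σ' (l + 1) i).cauchy z)
      fun i hi => by simp [hne i hi], hγ j hlj hjm z hz]
    simp [δ]
    have e1 := hinv₀ z hz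
    have e2 := hD z hz
    rw [h2] at e1
    linear_combination -e1 + (σ (l + 1)).cauchy z * z * hγ0 -
      (σ (l + 1)).cauchy z * (β₀ + F.b * γ j - F.a * (nikSys σ₀ (l + 1) j).total) * e2
  · rw [sum_Icc_eq_add_sum_Icc_succ hlm.le, nikSys_self σ', hσ1]
    obtain rfl | hk := (Nat.succ_le_of_lt hk).eq_or_lt
    · change (nikSys σ (l + 1) (l + 1)).cauchy z = _
      rw [nikSys_self, hw z hz, Finset.sum_eq_zero fun i hi => by simp [hne i hi]]
      simp
    · have h2 := hfac hz (p := 0) (q := F.const k) (d := fun i => F.c i k) fun x hx =>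
        (hcau k hk hkm hkj x (ofReal_notMem_cSet hd hx)).trans (by simp)
      have hk2 : l + 1 < k := hk
      have h3 := ((hτ₀.carried.mono hΔ₀ h1.isCompact).cauchy_nik (ht₀ k hk hkm) hd hz).trans h2
      rw [← hσ₀l, ← nikSys_of_lt σ₀ hk2] at h3
      rw [Finset.sum_congr rfl (g := fun i => -(F.c i k * (nikSys σ' (l + 1) i).cauchy z))
        fun i hi => by simp [hne i hi, hk2.ne', (show k ≠ l by omega)], Finset.sum_neg_distrib,
        hγ k hk hkm z hz, hγ j hlj hjm z hz, h3, hγC k hk hkm hkj]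
      simp [hk2.ne', (show k ≠ l by omega)]
      ring

theorem IsNik.nonempty_factorization {σ : ℕ → SignedM} {Δ : ℕ → Set ℝ} {l m j : ℕ}
    (h : IsNik σ Δ (l + 1) m) (hlj : l < j) (hjm : j ≤ m) (n : ℕ → ℕ) :
    Nonempty (Factorization σ Δ l m j n) := by
  obtain ⟨d, hd⟩ : ∃ d, m ≤ l + d := ⟨m, by omega⟩
  induction d generalizing σ Δ l n with
  | zero => omega
  | succ d ih =>
    obtain rfl | hlj' := (Nat.succ_le_of_lt hlj).eq_or_lt
    · exact Factorization.nonempty_of_head h hjm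
    obtain hn | hn := le_total (n (l + 1)) (n l)
    · obtain ⟨F⟩ := ih h.tail hlj' n (by omega)
      exact F.nonempty_of_le h hlj' hjm hn
    · exact Factorization.nonempty_of_lt h hlj' hjm hn fun σ' Δ' h' => ih h' hlj' _ (by omega)

namespace Factorization

variable {σ : ℕ → SignedM} {Δ : ℕ → Set ℝ} {m j : ℕ} {n : ℕ → ℕ} (F : Factorization σ Δ 0 m j n)

/-- The coefficients of the linear form obtained after dividing by the `j`-th Cauchy transform. -/
def form (p : ℕ → ℝ[X]) (i : ℕ) : ℝ[X] :=
  if i = 0 then p 0 * (C F.a * X + C F.b) + p j + ∑ k ∈ (Finset.Icc 1 m).erase j, F.const k • p k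
  else F.c i 0 • p 0 + ∑ k ∈ (Finset.Icc 1 m).erase j, F.c i k • p k

theorem degree_form_zero_lt (hmax0 : n 0 + 1 ≤ n j) (hmax : ∀ k, 1 ≤ k → k ≤ m → n k ≤ n j)
    (hjm : j ≤ m) {p : ℕ → ℝ[X]} (hp : ∀ k ≤ m, (p k).degree < (n k : WithBot ℕ)) :
    (F.form p 0).degree < (n j : WithBot ℕ) := by
  have hbot : (⊥ : WithBot ℕ) < n j := WithBot.bot_lt_coe _
  rw [form, if_pos rfl]
  refine (degree_add_le _ _).trans_lt
    (max_lt ((degree_add_le _ _).trans_lt (max_lt ?_ (hp j hjm))) ?_)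
  · obtain hp0 | hp0 := eq_or_ne (p 0) 0
    · simp [hp0, hbot]
    calc _ ≤ (p 0).degree + (C F.a * X + C F.b).degree := degree_mul_le _ _
      _ ≤ (p 0).degree + 1 := by gcongr; exact degree_linear_le
      _ < n 0 + 1 := WithBot.add_lt_add_right (by simp) (hp 0 (Nat.zero_le _))
      _ ≤ n j := by exact_mod_cast hmax0
  · refine (degree_sum_le _ _).trans_lt ((Finset.sup_lt_iff hbot).2 fun k hk => ?_)
    obtain ⟨-, hk⟩ := Finset.mem_erase.1 hk
    obtain ⟨h1, h2⟩ := Finset.mem_Icc.1 hk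
    exact (degree_smul_le _ _).trans_lt ((hp k h2).trans_le (by exact_mod_cast hmax k h1 h2))

theorem degree_form_lt (hj : j ≠ 0) {p : ℕ → ℝ[X]}
    (hp : ∀ k ≤ m, (p k).degree < (n k : WithBot ℕ)) {i : ℕ} (hi : 0 < i) (him : i ≤ m) :
    (F.form p i).degree < (n (F.e i) : WithBot ℕ) := by
  have hbot : (⊥ : WithBot ℕ) < n (F.e i) := WithBot.bot_lt_coe _
  have hk (k : ℕ) (hkm : k ≤ m) (hkj : k ≠ j) :
      (F.c i k • p k).degree < (n (F.e i) : WithBot ℕ) := by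
    by_cases hc : F.c i k = 0
    · simp [hc, hbot]
    · exact (degree_smul_le _ _).trans_lt ((hp k hkm).trans_le
        (by exact_mod_cast F.le_of_ne_zero i k hi him (Nat.zero_le _) hkm hkj hc))
  rw [form, if_neg hi.ne']
  refine (degree_add_le _ _).trans_lt (max_lt (hk 0 (Nat.zero_le _) hj.symm) ?_)
  refine (degree_sum_le _ _).trans_lt ((Finset.sup_lt_iff hbot).2 fun k hk' => ?_)
  obtain ⟨hkj, hk'⟩ := Finset.mem_erase.1 hk'
  exact hk k (Finset.mem_Icc.1 hk').2 hkj

theorem linear_form_eq (hj1 : 1 ≤ j) (hjm : j ≤ m) (p : ℕ → ℝ[X]) {z : ℂ}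
    (hz : z ∉ cSet (Δ 1)) :
    aeval z (p 0) + ∑ k ∈ Finset.Icc 1 m, aeval z (p k) * (nikSys σ 1 k).cauchy z =
      (aeval z (F.form p 0) +
        ∑ k ∈ Finset.Icc 1 m, aeval z (F.form p k) * (nikSys F.meas 1 k).cauchy z) *
      (nikSys σ 1 j).cauchy z := by
  have hone := F.one_eq z hz
  have hsum : ∑ k ∈ (Finset.Icc 1 m).erase j, aeval z (p k) * (nikSys σ 1 k).cauchy z =
      (∑ k ∈ (Finset.Icc 1 m).erase j, F.const k * aeval z (p k) + ∑ i ∈ Finset.Icc 1 m,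
        (∑ k ∈ (Finset.Icc 1 m).erase j, F.c i k * aeval z (p k)) *
          (nikSys F.meas 1 i).cauchy z) * (nikSys σ 1 j).cauchy z := by
    simp_rw [Finset.sum_mul]
    rw [Finset.sum_comm, ← Finset.sum_add_distrib, Finset.sum_mul]
    refine Finset.sum_congr rfl fun k hk => ?_
    obtain ⟨hkj, hk⟩ := Finset.mem_erase.1 hk
    obtain ⟨h1, h2⟩ := Finset.mem_Icc.1 hk
    rw [F.cauchy_eq k h1 h2 hkj z hz, zero_add, mul_left_comm, mul_add, Finset.mul_sum, mul_comm]
    congr 2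
    · ring
    · exact Finset.sum_congr rfl fun i _ => by ring
  have hform : ∑ i ∈ Finset.Icc 1 m, aeval z (F.form p i) * (nikSys F.meas 1 i).cauchy z =
      aeval z (p 0) * ∑ i ∈ Finset.Icc 1 m, F.c i 0 * (nikSys F.meas 1 i).cauchy z +
      ∑ i ∈ Finset.Icc 1 m, (∑ k ∈ (Finset.Icc 1 m).erase j, F.c i k * aeval z (p k)) *
        (nikSys F.meas 1 i).cauchy z := by
    rw [Finset.mul_sum, ← Finset.sum_add_distrib]
    refine Finset.sum_congr rfl fun i hi => ?_
    have : i ≠ 0 := by have := (Finset.mem_Icc.1 hi).1; omega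
    simp only [form, if_neg this, map_add, map_sum, map_smul, Complex.real_smul]
    ring
  rw [← Finset.add_sum_erase _ _ (Finset.mem_Icc.2 ⟨hj1, hjm⟩), hsum, hform]
  simp only [form, if_pos, map_add, map_mul, map_sum, map_smul, Complex.real_smul, aeval_C,
    aeval_X, Complex.coe_algebraMap]
  rw [zero_add] at hone
  linear_combination aeval z (p 0) * hone

end Factorization

theorem bijOn_update_zero {e : ℕ → ℕ} {m j : ℕ} (hjm : j ≤ m)
    (he : BijOn e (Icc 1 m) (Icc 0 m \ {j})) :
    BijOn (Function.update e 0 j) (Iic m) (Iic m) := by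
  have h1 : insert 0 (Icc 1 m) = Iic m := by
    ext x; simp only [mem_insert_iff, mem_Icc, mem_Iic]; omega
  have h2 : insert j (Icc 0 m \ {j}) = Iic m := by
    ext x; simp only [mem_insert_iff, Set.mem_sdiff, mem_Icc, mem_Iic, mem_singleton_iff]; omega
  have h3 : BijOn (Function.update e 0 j) (Icc 1 m) (Icc 0 m \ {j}) :=
    he.congr fun x hx => (Function.update_of_ne (by have := hx.1; omega) _ _).symm
  have h4 := h3.insert (a := 0) (by simp)
  rwa [Function.update_self, h1, h2] at h4

/-- Lemma 1.4: if `n_j = max{n₀+1, n₁, …, n_m}` for some `j ∈ {1,…,m}`, then there exist a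
Nikishin system `N(σ₁*, …, σ_m*)` (on subintervals of the original ones) and a permutation
`n*` of `n` with `n₀* = n_j` such that every linear form
`p₀ + Σ p_k ŝ_{1,k}` factors as `(p₀* + Σ p_k* ŝ*_{1,k})·ŝ_{1,j}` with `deg p_k* ≤ n_k* − 1`. -/
theorem stmt6
    (m : ℕ) (hm : 1 ≤ m)
    (σ : ℕ → SignedM) (Δ : ℕ → Set ℝ)
    (hσ : ∀ i, 1 ≤ i → i ≤ m → IsM (σ i) (Δ i))
    (hdisj : ∀ i, 1 ≤ i → i + 1 ≤ m → Δ i ∩ Δ (i + 1) = ∅)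
    (n : ℕ → ℕ) (j : ℕ) (hj1 : 1 ≤ j) (hjm : j ≤ m)
    (hmax0 : n 0 + 1 ≤ n j) (hmax : ∀ k, 1 ≤ k → k ≤ m → n k ≤ n j) :
    ∃ (σ' : ℕ → SignedM) (Δ' : ℕ → Set ℝ) (n' : ℕ → ℕ) (e : ℕ → ℕ),
      (∀ i, 1 ≤ i → i ≤ m → Δ' i ⊆ Δ i ∧ IsM (σ' i) (Δ' i)) ∧
      (∀ i, 1 ≤ i → i + 1 ≤ m → Δ' i ∩ Δ' (i + 1) = ∅) ∧
      Set.BijOn e (Set.Iic m) (Set.Iic m) ∧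
      (∀ k ≤ m, n' k = n (e k)) ∧
      n' 0 = n j ∧
      (∀ p : ℕ → Polynomial ℝ, (∀ k ≤ m, (p k).degree < (n k : WithBot ℕ)) →
        ∃ q : ℕ → Polynomial ℝ, (∀ k ≤ m, (q k).degree < (n' k : WithBot ℕ)) ∧
          ∀ z : ℂ, z ∉ cSet (Δ 1) →
            aeval z (p 0) +
                ∑ k ∈ Finset.Icc 1 m, aeval z (p k) * (nikSys σ 1 k).cauchy z =
              (aeval z (q 0) +
                  ∑ k ∈ Finset.Icc 1 m, aeval z (q k) * (nikSys σ' 1 k).cauchy z) *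
                (nikSys σ 1 j).cauchy z) := by
  have hN : IsNik σ Δ 1 m := ⟨hσ, fun i h1 h2 => disjoint_iff_inter_eq_empty.2 (hdisj i h1 h2)⟩
  have hj0 : j ≠ 0 := by omega
  obtain ⟨F⟩ := hN.nonempty_factorization (l := 0) hj1 hjm n
  refine ⟨F.meas, F.itv, fun k => n (Function.update F.e 0 j k), Function.update F.e 0 j,
    fun i h1 h2 => ⟨F.itv_subset i h1 h2, F.isNik.isM i h1 h2⟩,
    fun i h1 h2 => disjoint_iff_inter_eq_empty.1 (F.isNik.disjoint i h1 h2),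
    bijOn_update_zero hjm F.bijOn, fun _ _ => rfl, by simp, fun p hp =>
    ⟨F.form p, fun k hk => ?_, fun z hz => F.linear_form_eq hj1 hjm p hz⟩⟩
  obtain rfl | hk0 := k.eq_zero_or_pos
  · simpa using F.degree_form_zero_lt hmax0 hmax hjm hp
  · simpa [hk0.ne'] using F.degree_form_lt hj0 hp hk0 hk
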